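/- Let 0 < ρ ≤ 1 and let a ∈ S^0_{ρ,0}(n,2) satisfy, for each multi-index α, sup_{x_0,ζ∈ℝⁿ} (∫_{B_1(x_0)}∫_{ℝⁿ} |∂_x^α a(x,ζ−η,η)|² dη dx)^{1/2} < ∞, where B_1(x_0) is the unit ball centred at x_0. Then for each N > n there is a constant C, independent of x_0, such that for all Schwartz functions f, g on ℝⁿ and all x_0 ∈ ℝⁿ, ∫_{B_1(x_0)} |T_a(f,g)(x)| dx ≤ C·( ∫_{ℝⁿ} |f(y)|²(1+|y−x_0|)^{−N} dy · ∫_{ℝⁿ} |g(z)|²(1+|z−x_0|)^{−N} dz )^{1/2}. -/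

import Mathlib

open MeasureTheory Metric Complex
open scoped ENNReal NNReal RealInnerProductSpace BigOperators

noncomputable section

abbrev Rn (n : ℕ) : Type := EuclideanSpace ℝ (Fin n)

/-- The bilinear Hörmander class `S^m_{ρ,δ}(n,2)`. -/
def BilinSmRhoDelta (n : ℕ) (m ρ δ : ℝ) (a : Rn n → Rn n → Rn n → ℂ) : Prop :=
  ContDiff ℝ (⊤ : ℕ∞) (fun p : Rn n × Rn n × Rn n => a p.1 p.2.1 p.2.2) ∧
  ∀ kx kξ kη : ℕ, ∃ C : ℝ, ∀ (x ξ η : Rn n),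
    ‖iteratedFDeriv ℝ kx
        (fun x' => iteratedFDeriv ℝ kξ
          (fun ξ' => iteratedFDeriv ℝ kη (fun η' => a x' ξ' η') η) ξ) x‖ ≤
      C * (1 + ‖ξ‖ ^ 2 + ‖η‖ ^ 2) ^ ((m - ρ * (kξ + kη) + δ * kx) / 2)

/-- The Fourier transform `f̂(ξ) = ∫ f(y) e^{-i ξ·y} dy`. -/
def fourierT {n : ℕ} (f : Rn n → ℂ) (ξ : Rn n) : ℂ :=
  ∫ y : Rn n, f y * Complex.exp (-Complex.I * (⟪ξ, y⟫ : ℂ))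

/-- The bilinear pseudodifferential operator
`T_a(f,g)(x) = ∬ a(x,ξ,η) f̂(ξ) ĝ(η) e^{ix·(ξ+η)} dξ dη`. -/
def Tbilin {n : ℕ} (a : Rn n → Rn n → Rn n → ℂ) (f g : Rn n → ℂ) (x : Rn n) : ℂ :=
  ∫ ξ : Rn n, ∫ η : Rn n,
    a x ξ η * fourierT f ξ * fourierT g η * Complex.exp (Complex.I * ((⟪x, ξ + η⟫ : ℝ) : ℂ))

open scoped FourierTransform SchwartzMap LineDeriv ContDiff

namespace BilinearPseudo

variable {n : ℕ}

/-- Dilation by `(2π)⁻¹` as a continuous linear equivalence. -/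
def dilation (n : ℕ) : Rn n ≃L[ℝ] Rn n :=
  ContinuousLinearEquiv.smulLeft (Units.mk0 ((2 * Real.pi)⁻¹ : ℝ) (by positivity))

theorem dilation_apply (ξ : Rn n) : dilation n ξ = (2 * Real.pi)⁻¹ • ξ := rfl

/-- The Fourier transform with the normalization of `fourierT`, as a Schwartz function. -/
def schwartzFT (f : 𝓢(Rn n, ℂ)) : 𝓢(Rn n, ℂ) :=
  SchwartzMap.compCLMOfContinuousLinearEquiv ℂ (dilation n) (𝓕 f)

theorem schwartzFT_eq_fourier (f : 𝓢(Rn n, ℂ)) (ξ : Rn n) :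
    schwartzFT f ξ = 𝓕 (f : Rn n → ℂ) ((2 * Real.pi)⁻¹ • ξ) := rfl

theorem fourier_smul_eq (f : Rn n → ℂ) (ξ : Rn n) :
    𝓕 f ((2 * Real.pi)⁻¹ • ξ) = ∫ y, f y * cexp (-I * (⟪ξ, y⟫ : ℂ)) := by
  rw [Real.fourier_eq']
  refine integral_congr_ae (.of_forall fun y => ?_)
  simp only [smul_eq_mul]
  rw [mul_comm, inner_smul_right, real_inner_comm]
  congr 2
  push_cast
  have : (Real.pi : ℂ) ≠ 0 := by exact_mod_cast Real.pi_ne_zero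
  field_simp

theorem schwartzFT_apply (f : 𝓢(Rn n, ℂ)) (ξ : Rn n) : schwartzFT f ξ = fourierT f ξ := by
  rw [schwartzFT_eq_fourier, fourier_smul_eq, fourierT]

theorem schwartzFT_add (f g : 𝓢(Rn n, ℂ)) : schwartzFT (f + g) = schwartzFT f + schwartzFT g := by
  simp [schwartzFT, FourierTransform.fourier_add]

theorem norm_schwartzFT_le (f : 𝓢(Rn n, ℂ)) (ξ : Rn n) : ‖schwartzFT f ξ‖ ≤ ∫ y, ‖f y‖ := by
  rw [schwartzFT_eq_fourier, Real.fourier_eq']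
  refine (norm_integral_le_integral_norm _).trans (le_of_eq ?_)
  refine integral_congr_ae (.of_forall fun y => ?_)
  simp only [norm_smul, norm_exp_ofReal_mul_I, one_mul]

theorem integral_norm_sq_schwartzFT (f : 𝓢(Rn n, ℂ)) :
    ∫ ξ, ‖schwartzFT f ξ‖ ^ 2 = (2 * Real.pi) ^ n * ∫ y, ‖f y‖ ^ 2 := by
  have h := Measure.integral_comp_inv_smul (μ := (volume : Measure (Rn n)))
    (fun ξ => ‖𝓕 (f : Rn n → ℂ) ξ‖ ^ 2) (2 * Real.pi)
  rw [← SchwartzMap.integral_norm_sq_fourier f]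
  simp only [finrank_euclideanSpace, Fintype.card_fin, smul_eq_mul] at h
  rw [abs_of_pos (by positivity)] at h
  exact h

/-- **Plancherel** for functions in `L¹ ∩ L²`. -/
theorem eLpNorm_fourier_eq {V : Type*} [NormedAddCommGroup V] [InnerProductSpace ℝ V]
    [FiniteDimensional ℝ V] [MeasurableSpace V] [BorelSpace V] {f : V → ℂ} (hf : Integrable f)
    (hf2 : MemLp f 2) : eLpNorm (𝓕 f) 2 volume = eLpNorm f 2 volume := by
  have hcont : Continuous (𝓕 f) :=
    VectorFourier.fourierIntegral_continuous Real.continuous_fourierChar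
      (by exact continuous_inner) hf
  set F : Lp ℂ 2 (volume : Measure V) := hf2.toLp f with hF
  set G : Lp ℂ 2 (volume : Measure V) := 𝓕 F with hG
  have hae : ∀ᵐ x, 𝓕 f x = G x := by
    refine ae_eq_of_integral_contDiff_smul_eq hcont.locallyIntegrable ?_ ?_
    · exact (Lp.memLp G).locallyIntegrable (by norm_num)
    intro g hg hgs
    have hg1 : HasCompactSupport (fun x => (g x : ℂ)) := hgs.comp_left (g := Complex.ofReal) (by simp)
    have hg2 : ContDiff ℝ ∞ (fun x => (g x : ℂ)) := Complex.ofRealCLM.contDiff.comp hg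
    have h1 := Lp.fourier_toTemperedDistribution_eq F
    have h2 := DFunLike.congr_fun h1 (hg1.toSchwartzMap hg2)
    rw [TemperedDistribution.fourier_apply, Lp.toTemperedDistribution_apply,
      Lp.toTemperedDistribution_apply] at h2
    have h3 := VectorFourier.integral_fourierIntegral_smul_eq_flip (μ := volume) (ν := volume)
      (L := innerₗ V)
      Real.continuous_fourierChar (by exact continuous_inner) (hg1.toSchwartzMap hg2).integrable hf
    rw [flip_innerₗ] at h3
    calc ∫ x, g x • 𝓕 f x = ∫ x, (hg1.toSchwartzMap hg2) x • 𝓕 f x := by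
          simp
      _ = ∫ x, (𝓕 (hg1.toSchwartzMap hg2)) x • f x := h3.symm
      _ = ∫ x, (𝓕 (hg1.toSchwartzMap hg2)) x • F x := by
          refine integral_congr_ae ?_
          filter_upwards [hf2.coeFn_toLp] with x hx
          rw [hF, hx]
      _ = ∫ x, (hg1.toSchwartzMap hg2) x • G x := h2
      _ = _ := by simp
  rw [eLpNorm_congr_ae hae]
  have := Lp.norm_fourier_eq F
  rw [Lp.norm_def, Lp.norm_def, ENNReal.toReal_eq_toReal_iff' (Lp.eLpNorm_ne_top _)
    (Lp.eLpNorm_ne_top _)] at this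
  rw [hG, this, eLpNorm_congr_ae hf2.coeFn_toLp]

theorem schwartzFT_smulLeft_inner (h : 𝓢(Rn n, ℂ)) (v ξ : Rn n) :
    schwartzFT (SchwartzMap.smulLeftCLM ℂ (inner ℝ · v) h) ξ = I * fderiv ℝ (schwartzFT h) ξ v := by
  have h1 : (inner ℝ · v : Rn n → ℝ).HasTemperateGrowth := by fun_prop
  have h2 : (fun x : Rn n => inner ℝ x ((2 * Real.pi)⁻¹ • v)) =
      (2 * Real.pi)⁻¹ • (inner ℝ · v) := by
    ext x
    simp [inner_smul_right]
  have h3 : -(2 * Real.pi * I) • SchwartzMap.smulLeftCLM ℂ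
      (fun x : Rn n => inner ℝ x ((2 * Real.pi)⁻¹ • v)) h =
      (-I) • SchwartzMap.smulLeftCLM ℂ (inner ℝ · v) h := by
    ext x
    rw [h2, SchwartzMap.smulLeftCLM_smul h1]
    have : (Real.pi : ℂ) ≠ 0 := by exact_mod_cast Real.pi_ne_zero
    simp
    field_simp
  have h4 : ∂_{v} (schwartzFT h) =
      (-I) • schwartzFT (SchwartzMap.smulLeftCLM ℂ (inner ℝ · v) h) := by
    rw [schwartzFT, SchwartzMap.lineDerivOp_compCLMOfContinuousLinearEquiv, dilation_apply,
      SchwartzMap.lineDerivOp_fourier_eq, h3, FourierTransform.fourier_smul, map_smul, schwartzFT]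
  rw [← SchwartzMap.lineDerivOp_apply_eq_fderiv, h4, smul_apply, smul_eq_mul,
    ← mul_assoc]
  simp

theorem integral_mul_schwartzFT_inner {c : Rn n → ℂ} (hc : ContDiff ℝ 1 c) {K K' : ℝ}
    (hK : ∀ η, ‖c η‖ ≤ K) (v : Rn n) (hK' : ∀ η, ‖fderiv ℝ c η v‖ ≤ K') (h : 𝓢(Rn n, ℂ)) :
    ∫ η, c η * schwartzFT (SchwartzMap.smulLeftCLM ℂ (inner ℝ · v) h) η =
      -I * ∫ η, fderiv ℝ c η v * schwartzFT h η := by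
  simp_rw [schwartzFT_smulLeft_inner]
  have hcc : Continuous c := hc.continuous
  have hdc : Continuous fun η => fderiv ℝ c η v :=
    (hc.continuous_fderiv one_ne_zero).clm_apply continuous_const
  have hi : Integrable (fun η => fderiv ℝ (schwartzFT h) η v) :=
    (SchwartzMap.evalCLM ℝ (Rn n) ℂ v (SchwartzMap.fderivCLM ℝ (Rn n) ℂ (schwartzFT h))).integrable
  have key := integral_mul_fderiv_eq_neg_fderiv_mul_of_integrable (μ := volume) (f := c)
    (g := schwartzFT h) (v := v)
    ((schwartzFT h).integrable.bdd_mul hdc.aestronglyMeasurable (.of_forall hK'))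
    (hi.bdd_mul hcc.aestronglyMeasurable (.of_forall hK))
    ((schwartzFT h).integrable.bdd_mul hcc.aestronglyMeasurable (.of_forall hK))
    (fun x _ => hc.differentiable one_ne_zero x)
    (fun x _ => (schwartzFT h).differentiableAt)
  have : ∀ η, c η * (I * fderiv ℝ (schwartzFT h) η v) =
      I * (c η * fderiv ℝ (schwartzFT h) η v) := fun η => by ring
  simp_rw [this]
  rw [integral_const_mul, key]
  ring

/-- A smooth function of temperate growth which agrees with `‖y‖⁻²` away from the unit ball. -/
theorem exists_temperate_inv_norm_sq (n : ℕ) :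
    ∃ u : Rn n → ℝ, u.HasTemperateGrowth ∧ ∀ y, 1 ≤ ‖y‖ → ‖y‖ ^ 2 * u y = 1 := by
  let χ : ContDiffBump (0 : ℝ) := ⟨1 / 2, 3 / 4, by norm_num, by norm_num⟩
  let κ : ℝ → ℝ := fun t => χ t / (1 - t)
  have hκc : HasCompactSupport κ := by
    refine χ.hasCompactSupport.mono fun t ht => ?_
    rw [Function.mem_support] at ht ⊢
    exact fun h => ht (by simp [κ, h])
  have hκ : ContDiff ℝ ∞ κ := by
    rw [contDiff_iff_contDiffAt]
    intro t
    by_cases ht : t = 1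
    · have : κ =ᶠ[nhds t] fun _ => 0 := by
        have : ∀ᶠ s in nhds t, (3 / 4 : ℝ) < s := lt_mem_nhds (by rw [ht]; norm_num)
        filter_upwards [this] with s hs
        have : χ s = 0 := χ.zero_of_le_dist (by
          simp only [Real.dist_eq, sub_zero]; exact hs.le.trans (le_abs_self s))
        simp [κ, this]
      exact contDiffAt_const.congr_of_eventuallyEq this
    · exact χ.contDiffAt.div (by fun_prop) (sub_ne_zero.2 (Ne.symm ht))
  have hs : (fun y : Rn n => (1 + ‖y‖ ^ 2) ^ (-1 : ℝ)).HasTemperateGrowth := by fun_prop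
  refine ⟨fun y => (1 + ‖y‖ ^ 2) ^ (-1 : ℝ) * κ ((1 + ‖y‖ ^ 2) ^ (-1 : ℝ)),
    hs.mul ((hκc.hasTemperateGrowth hκ).comp hs), fun y hy => ?_⟩
  have h1 : 1 ≤ ‖y‖ ^ 2 := one_le_pow₀ hy
  simp only [Real.rpow_neg_one, κ]
  have : χ (1 + ‖y‖ ^ 2)⁻¹ = 1 := χ.one_of_mem_closedBall (by
    simp only [mem_closedBall, Real.dist_eq, sub_zero]
    rw [abs_of_pos (by positivity)]
    show _ ≤ (1 / 2 : ℝ)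
    rw [inv_le_comm₀ (by positivity) (by norm_num)]
    linarith)
  rw [this]
  have h3 : 1 - (1 + ‖y‖ ^ 2)⁻¹ = ‖y‖ ^ 2 * (1 + ‖y‖ ^ 2)⁻¹ := by field_simp; ring
  rw [h3]
  field_simp

theorem sum_single_inner_smul (y : Rn n) :
    ∑ k, inner ℝ y (EuclideanSpace.single k (1 : ℝ)) *
      inner ℝ y (EuclideanSpace.single k (1 : ℝ)) = ‖y‖ ^ 2 := by
  rw [EuclideanSpace.norm_sq_eq]
  refine Finset.sum_congr rfl fun k _ => ?_
  simp [EuclideanSpace.inner_single_right, sq]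

theorem schwartzFT_sum {ι : Type*} (s : Finset ι) (F : ι → 𝓢(Rn n, ℂ)) :
    schwartzFT (∑ k ∈ s, F k) = ∑ k ∈ s, schwartzFT (F k) := by
  classical
  induction s using Finset.induction_on with
  | empty =>
    have := schwartzFT_add (0 : 𝓢(Rn n, ℂ)) 0
    simpa using this
  | insert a s ha ih => rw [Finset.sum_insert ha, Finset.sum_insert ha, schwartzFT_add, ih]

theorem fderiv_iteratedFDeriv_apply {c : Rn n → ℂ} (hc : ContDiff ℝ ∞ c) (L : ℕ) (η : Rn n)
    (m : Fin (L + 1) → Rn n) :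
    fderiv ℝ (fun η => iteratedFDeriv ℝ L c η (Fin.tail m)) η (m 0) =
      iteratedFDeriv ℝ (L + 1) c η m := by
  rw [iteratedFDeriv_succ_apply_left, fderiv_continuousMultilinear_apply_const_apply]
  exact hc.differentiable_iteratedFDeriv (by exact_mod_cast ENat.natCast_lt_top L) η

theorem norm_iteratedFDeriv_single_le (L : ℕ) (c : Rn n → ℂ) (η : Rn n) (i : Fin L → Fin n) :
    ‖iteratedFDeriv ℝ L c η (fun j => EuclideanSpace.single (i j) (1 : ℝ))‖ ≤
      ‖iteratedFDeriv ℝ L c η‖ := by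
  refine (ContinuousMultilinearMap.le_opNorm _ _).trans ?_
  simp

/-- Iterated integration by parts: if `h` vanishes on the open unit ball (needed only for `L ≠ 0`),
pairing with its Fourier transform gains `L` derivatives and a weight `‖y‖ ^ (-L)`. -/
theorem exists_integral_mul_schwartzFT_eq (h : 𝓢(Rn n, ℂ)) (L : ℕ)
    (hh : L ≠ 0 → ∀ y, ‖y‖ < 1 → h y = 0) :
    ∃ (hs : (Fin L → Fin n) → 𝓢(Rn n, ℂ)),
      (∀ i y, h y = 0 → hs i y = 0) ∧ (∀ i y, ‖hs i y‖ * ‖y‖ ^ L ≤ ‖h y‖) ∧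
      ∀ c : Rn n → ℂ, ContDiff ℝ ∞ c → (∀ k, ∃ K, ∀ η, ‖iteratedFDeriv ℝ k c η‖ ≤ K) →
        ∫ η, c η * schwartzFT h η = (-I) ^ L * ∑ i, ∫ η,
          iteratedFDeriv ℝ L c η (fun j => EuclideanSpace.single (i j) (1 : ℝ)) *
            schwartzFT (hs i) η := by
  induction L with
  | zero =>
    refine ⟨fun _ => h, fun _ _ hy => hy, fun _ _ => by simp, fun c _ _ => ?_⟩
    simp
  | succ L ih =>
    obtain ⟨hs, hs0, hs1, hs2⟩ := ih fun _ => hh (by simp)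
    obtain ⟨u, hu, hu1⟩ := exists_temperate_inv_norm_sq n
    let e : Fin n → Rn n := fun k => EuclideanSpace.single k (1 : ℝ)
    have he : ∀ k, (inner ℝ · (e k) : Rn n → ℝ).HasTemperateGrowth := fun k => by fun_prop
    let W : (Fin L → Fin n) → Fin n → 𝓢(Rn n, ℂ) := fun j k =>
      SchwartzMap.smulLeftCLM ℂ (inner ℝ · (e k)) (SchwartzMap.smulLeftCLM ℂ u (hs j))
    have hW : ∀ j k y, W j k y = (inner ℝ y (e k) : ℝ) • u y • hs j y := fun j k y => by
      rw [SchwartzMap.smulLeftCLM_apply_apply (he k), SchwartzMap.smulLeftCLM_apply_apply hu]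
    have hv : ∀ j y, ‖y‖ < 1 → hs j y = 0 := fun j y hy => hs0 j y (hh (by simp) y hy)
    have hsum : ∀ j, hs j = ∑ k, SchwartzMap.smulLeftCLM ℂ (inner ℝ · (e k)) (W j k) := by
      intro j
      ext y
      rw [sum_apply]
      simp_rw [SchwartzMap.smulLeftCLM_apply_apply (he _), hW, smul_smul]
      simp_rw [← mul_assoc]
      rw [← Finset.sum_smul, ← Finset.sum_mul, sum_single_inner_smul]
      rcases lt_or_ge ‖y‖ 1 with hy | hy
      · rw [hv j y hy, smul_zero]
      · rw [hu1 y hy, one_smul]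
    refine ⟨fun i => W (Fin.tail i) (i 0), fun i y hy => ?_, fun i y => ?_, fun c hc hK => ?_⟩
    · simp only [hW]
      rw [hs0 _ y hy, smul_zero, smul_zero]
    · rcases lt_or_ge ‖y‖ 1 with hy | hy
      · simp only [hW]
        rw [hv _ y hy]
        simp
      · simp only [hW]
        have h1 : |inner ℝ y (e (i 0))| ≤ ‖y‖ := by
          refine (abs_real_inner_le_norm _ _).trans ?_
          simp [e]
        have hup : 0 ≤ u y := by
          by_contra hneg
          nlinarith [hu1 y hy, sq_nonneg ‖y‖]
        rw [norm_smul, norm_smul, Real.norm_eq_abs, Real.norm_eq_abs, abs_of_nonneg hup]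
        calc |inner ℝ y (e (i 0))| * (u y * ‖hs (Fin.tail i) y‖) * ‖y‖ ^ (L + 1)
            ≤ ‖y‖ * (u y * ‖hs (Fin.tail i) y‖) * ‖y‖ ^ (L + 1) := by gcongr
          _ = (‖y‖ ^ 2 * u y) * (‖hs (Fin.tail i) y‖ * ‖y‖ ^ L) := by ring
          _ ≤ ‖h y‖ := by rw [hu1 y hy, one_mul]; exact hs1 _ y
    · rw [hs2 c hc hK]
      have step : ∀ j : Fin L → Fin n,
          ∫ η, iteratedFDeriv ℝ L c η (fun m => e (j m)) * schwartzFT (hs j) η =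
            -I * ∑ k, ∫ η, iteratedFDeriv ℝ (L + 1) c η
              (Fin.cons (e k) (fun m => e (j m)) : Fin (L + 1) → Rn n) *
                schwartzFT (W j k) η := by
        intro j
        obtain ⟨K, hKL⟩ := hK L
        obtain ⟨K', hKL'⟩ := hK (L + 1)
        have hcs : ContDiff ℝ 1 fun η => iteratedFDeriv ℝ L c η (fun m => e (j m)) := by
          have := hc.iteratedFDeriv_right (m := 1) (i := L) (by
            norm_cast; exact le_top)
          exact (ContinuousMultilinearMap.apply ℝ (fun _ : Fin L => Rn n) ℂ
            (fun m => e (j m))).contDiff.comp this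
        have hb : ∀ η, ‖iteratedFDeriv ℝ L c η (fun m => e (j m))‖ ≤ K := fun η =>
          (norm_iteratedFDeriv_single_le L c η j).trans (hKL η)
        have hfd : ∀ k η, fderiv ℝ (fun η => iteratedFDeriv ℝ L c η (fun m => e (j m))) η (e k) =
            iteratedFDeriv ℝ (L + 1) c η
              (Fin.cons (e k) (fun m => e (j m)) : Fin (L + 1) → Rn n) := fun k η => by
          have := fderiv_iteratedFDeriv_apply hc L η
            (Fin.cons (e k) (fun m => e (j m)) : Fin (L + 1) → Rn n)
          simpa using this
        have hb' : ∀ k η,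
            ‖fderiv ℝ (fun η => iteratedFDeriv ℝ L c η (fun m => e (j m))) η (e k)‖ ≤ K' := by
          intro k η
          rw [hfd]
          refine ((ContinuousMultilinearMap.le_opNorm _ _).trans ?_).trans (hKL' η)
          rw [Fin.prod_univ_succ]
          simp [e]
        nth_rw 1 [hsum j]
        rw [schwartzFT_sum]
        simp_rw [sum_apply, Finset.mul_sum]
        rw [integral_finsetSum]
        · refine Finset.sum_congr rfl fun k _ => ?_
          rw [integral_mul_schwartzFT_inner hcs hb (e k) (hb' k)]
          simp_rw [hfd]
        · exact fun k _ => (schwartzFT _).integrable.bdd_mul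
            hcs.continuous.aestronglyMeasurable (.of_forall hb)
      change (-I) ^ L * ∑ j, ∫ η, iteratedFDeriv ℝ L c η (fun m => e (j m)) *
        schwartzFT (hs j) η = _
      simp_rw [step]
      rw [← Finset.mul_sum, ← mul_assoc, ← pow_succ]
      congr 1
      rw [← (Fin.consEquiv fun _ => Fin n).sum_comp, Fintype.sum_prod_type, Finset.sum_comm]
      refine Finset.sum_congr rfl fun k _ => Finset.sum_congr rfl fun j _ => ?_
      refine integral_congr_ae (.of_forall fun η => ?_)
      have : (Fin.cons (e k) (fun m => e (j m)) : Fin (L + 1) → Rn n) =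
          fun m => e ((Fin.consEquiv fun _ => Fin n) (k, j) m) := by
        ext m
        refine Fin.cases ?_ (fun m => ?_) m <;> simp [Fin.consEquiv]
      simp only [this]
      simp [Fin.consEquiv, e]

section Partial

variable {E₁ E₂ G : Type*} [NormedAddCommGroup E₁] [NormedSpace ℝ E₁] [NormedAddCommGroup E₂]
  [NormedSpace ℝ E₂] [NormedAddCommGroup G] [NormedSpace ℝ G]

theorem iteratedFDeriv_prodMk_right {F : E₁ × E₂ → G} (hF : ContDiff ℝ ∞ F) (k : ℕ) (x : E₁)
    (y : E₂) : iteratedFDeriv ℝ k (fun y' => F (x, y')) y =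
      (iteratedFDeriv ℝ k F (x, y)).compContinuousLinearMap
        (fun _ => ContinuousLinearMap.inr ℝ E₁ E₂) := by
  have h1 : (fun y' => F (x, y')) =
      (fun p => F (p + (x, 0))) ∘ ContinuousLinearMap.inr ℝ E₁ E₂ := by
    ext y'; simp
  have h2 : ContDiff ℝ ∞ (fun p => F (p + (x, 0))) := by fun_prop
  rw [h1, ContinuousLinearMap.iteratedFDeriv_comp_right _ h2 y (i := k) (by exact_mod_cast le_top),
    iteratedFDeriv_comp_add_right]
  simp

theorem contDiff_iteratedFDeriv_prodMk_right {F : E₁ × E₂ → G} (hF : ContDiff ℝ ∞ F) (k : ℕ) :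
    ContDiff ℝ ∞ (fun p : E₁ × E₂ => iteratedFDeriv ℝ k (fun y' => F (p.1, y')) p.2) := by
  have : (fun p : E₁ × E₂ => iteratedFDeriv ℝ k (fun y' => F (p.1, y')) p.2) =
      fun p => ContinuousMultilinearMap.compContinuousLinearMapL
        (fun _ : Fin k => ContinuousLinearMap.inr ℝ E₁ E₂) (iteratedFDeriv ℝ k F p) := by
    ext1 p
    rw [iteratedFDeriv_prodMk_right hF]
    rfl
  rw [this]
  refine ContinuousLinearMap.contDiff _ |>.comp ?_
  exact hF.iteratedFDeriv_right (by exact_mod_cast le_top)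

theorem contDiff_iteratedFDeriv_prodMk_left {F : E₁ × E₂ → G} (hF : ContDiff ℝ ∞ F) (k : ℕ) :
    ContDiff ℝ ∞ (fun p : E₁ × E₂ => iteratedFDeriv ℝ k (fun x' => F (x', p.2)) p.1) := by
  have h : ContDiff ℝ ∞ (fun q : E₂ × E₁ => F (q.2, q.1)) := by fun_prop
  exact (contDiff_iteratedFDeriv_prodMk_right h k).comp (contDiff_snd.prodMk contDiff_fst)

end Partial

theorem norm_continuousMultilinearMap_apply_le {ι E : Type*} [Fintype ι] [NormedAddCommGroup E]
    [NormedSpace ℝ E] (v : ι → E) (hv : ∀ i, ‖v i‖ ≤ 1) :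
    ‖ContinuousMultilinearMap.apply ℝ (fun _ : ι => E) ℂ v‖ ≤ 1 := by
  refine ContinuousLinearMap.opNorm_le_bound _ zero_le_one fun m => ?_
  rw [one_mul]
  refine (m.le_opNorm v).trans ?_
  exact mul_le_of_le_one_right (norm_nonneg _)
    (Finset.prod_le_one (fun _ _ => norm_nonneg _) fun i _ => hv i)

/-- A weight of the form `(1 + |ξ|² + |η|²)^{-s}` splits as a product. -/
theorem rpow_one_add_norm_sq_le (ξ η : Rn n) {s : ℝ} (hs : 0 ≤ s) :
    (1 + ‖ξ‖ ^ 2 + ‖η‖ ^ 2) ^ (-s) ≤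
      (1 + ‖ξ‖ ^ 2) ^ (-s / 2) * (1 + ‖η‖ ^ 2) ^ (-s / 2) := by
  have h0 : 0 < 1 + ‖ξ‖ ^ 2 + ‖η‖ ^ 2 := by positivity
  have : (1 + ‖ξ‖ ^ 2 + ‖η‖ ^ 2) ^ (-s) = (1 + ‖ξ‖ ^ 2 + ‖η‖ ^ 2) ^ (-s / 2) *
      (1 + ‖ξ‖ ^ 2 + ‖η‖ ^ 2) ^ (-s / 2) := by
    rw [← Real.rpow_add h0]; congr 1; ring
  rw [this]
  gcongr ?_ * ?_
  · exact Real.rpow_le_rpow_of_nonpos (by positivity) (by nlinarith [sq_nonneg ‖η‖]) (by linarith)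
  · exact Real.rpow_le_rpow_of_nonpos (by positivity) (by nlinarith [sq_nonneg ‖ξ‖]) (by linarith)

/-- The integral of the weight `(1 + |ξ|²)^{-s/2}`. -/
def weightMass (n : ℕ) (s : ℝ) : ℝ := ∫ ξ : Rn n, (1 + ‖ξ‖ ^ 2) ^ (-s / 2)

theorem weightMass_nonneg (n : ℕ) (s : ℝ) : 0 ≤ weightMass n s :=
  integral_nonneg fun _ => by positivity

theorem integrable_weight {s : ℝ} (hs : (n : ℝ) < s) :
    Integrable (fun ξ : Rn n => (1 + ‖ξ‖ ^ 2) ^ (-s / 2)) :=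
  integrable_rpow_neg_one_add_norm_sq (by simpa using hs)

/-- Fubini for a bounded continuous kernel against two Schwartz functions. -/
theorem integral_integral_swap_of_bounded {c : Rn n → Rn n → ℂ}
    (hc : Continuous (fun p : Rn n × Rn n => c p.1 p.2)) {K : ℝ} (hK : ∀ ξ η, ‖c ξ η‖ ≤ K)
    (F G : 𝓢(Rn n, ℂ)) :
    Integrable (fun p : Rn n × Rn n => c p.1 p.2 * (F p.1 * G p.2)) (volume.prod volume) := by
  refine Integrable.bdd_mul (F.integrable.mul_prod G.integrable)
    hc.aestronglyMeasurable (c := K) (.of_forall fun p => hK _ _)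

theorem norm_le_of_norm_mul_pow_le {h k : Rn n → ℂ} {P : Rn n → ℝ} {L : ℕ}
    (hP : ∀ y, 0 ≤ P y) (hL : L ≠ 0 → ∀ y, ‖y‖ < 1 → h y = 0)
    (hk0 : ∀ y, h y = 0 → k y = 0) (hk : ∀ y, ‖k y‖ * ‖y‖ ^ L ≤ ‖h y‖)
    (hh : ∀ y, ‖h y‖ ≤ P y * ‖y‖ ^ L) (y : Rn n) : ‖k y‖ ≤ P y := by
  by_cases hL0 : L = 0
  · subst hL0
    simpa using (hk y).trans (hh y)
  by_cases hy : ‖y‖ = 0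
  · rw [hk0 y (hL hL0 y (by rw [hy]; norm_num))]
    simpa using hP y
  · have hpos : 0 < ‖y‖ ^ L := by positivity
    exact le_of_mul_le_mul_right ((hk y).trans (hh y)) hpos

/-- Repeated integration by parts in both frequency variables: a double oscillatory integral is
controlled by one mixed derivative of the symbol. -/
theorem norm_integral_integral_schwartzFT_le {C s : ℝ} (hC : 0 ≤ C) (hs : (n : ℝ) < s)
    (L₁ L₂ : ℕ) {b : Rn n → Rn n → ℂ}
    (hb : ContDiff ℝ ∞ (fun p : Rn n × Rn n => b p.1 p.2))
    (hbd : ∀ k₁ k₂ : ℕ, ∃ K, ∀ ξ η,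
      ‖iteratedFDeriv ℝ k₁ (fun ξ' => iteratedFDeriv ℝ k₂ (b ξ') η) ξ‖ ≤ K)
    (hbL : ∀ ξ η, ‖iteratedFDeriv ℝ L₁ (fun ξ' => iteratedFDeriv ℝ L₂ (b ξ') η) ξ‖ ≤
      C * (1 + ‖ξ‖ ^ 2 + ‖η‖ ^ 2) ^ (-s))
    (F G : 𝓢(Rn n, ℂ)) (hF0 : L₁ ≠ 0 → ∀ y, ‖y‖ < 1 → F y = 0)
    (hG0 : L₂ ≠ 0 → ∀ y, ‖y‖ < 1 → G y = 0) {P₁ P₂ : Rn n → ℝ} (hP₁ : ∀ y, 0 ≤ P₁ y)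
    (hP₂ : ∀ y, 0 ≤ P₂ y) (hP₁i : Integrable P₁) (hP₂i : Integrable P₂)
    (hF : ∀ y, ‖F y‖ ≤ P₁ y * ‖y‖ ^ L₁) (hG : ∀ y, ‖G y‖ ≤ P₂ y * ‖y‖ ^ L₂) :
    ‖∫ ξ, ∫ η, b ξ η * schwartzFT F ξ * schwartzFT G η‖ ≤
      (n ^ L₁ * n ^ L₂ * C * weightMass n s ^ 2) * ((∫ y, P₁ y) * ∫ y, P₂ y) := by
  obtain ⟨Gs, hGs0, hGsn, hGs⟩ := exists_integral_mul_schwartzFT_eq G L₂ hG0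
  obtain ⟨Fs, hFs0, hFsn, hFs⟩ := exists_integral_mul_schwartzFT_eq F L₁ hF0
  have hFle : ∀ j ξ, ‖schwartzFT (Fs j) ξ‖ ≤ ∫ y, P₁ y := fun j ξ =>
    (norm_schwartzFT_le _ _).trans <| integral_mono (Fs j).integrable.norm hP₁i
      (norm_le_of_norm_mul_pow_le hP₁ hF0 (hFs0 j) (hFsn j) hF)
  have hGle : ∀ j ξ, ‖schwartzFT (Gs j) ξ‖ ≤ ∫ y, P₂ y := fun j ξ =>
    (norm_schwartzFT_le _ _).trans <| integral_mono (Gs j).integrable.norm hP₂i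
      (norm_le_of_norm_mul_pow_le hP₂ hG0 (hGs0 j) (hGsn j) hG)
  have hen : ∀ {L : ℕ} (i : Fin L → Fin n) (j : Fin L),
      ‖(EuclideanSpace.single (i j) (1 : ℝ) : Rn n)‖ ≤ 1 := by
    intro L i j; simp
  set c : (Fin L₂ → Fin n) → Rn n → Rn n → ℂ :=
    fun i η ξ => iteratedFDeriv ℝ L₂ (b ξ) η fun j => EuclideanSpace.single (i j) (1 : ℝ) with hc
  have hDsmooth : ContDiff ℝ ∞ (fun p : Rn n × Rn n => iteratedFDeriv ℝ L₂ (b p.1) p.2) :=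
    contDiff_iteratedFDeriv_prodMk_right hb L₂
  have hcsmooth : ∀ i, ContDiff ℝ ∞ (fun p : Rn n × Rn n => c i p.2 p.1) := fun i =>
    (ContinuousMultilinearMap.apply ℝ (fun _ : Fin L₂ => Rn n) ℂ
      fun j => EuclideanSpace.single (i j) (1 : ℝ)).contDiff.comp hDsmooth
  have hcη : ∀ i η, ContDiff ℝ ∞ (c i η) := fun i η =>
    (hcsmooth i).comp (contDiff_id.prodMk contDiff_const)
  have hcd : ∀ i k ξ η, ‖iteratedFDeriv ℝ k (c i η) ξ‖ ≤
      ‖iteratedFDeriv ℝ k (fun ξ' => iteratedFDeriv ℝ L₂ (b ξ') η) ξ‖ := by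
    intro i k ξ η
    have h1 : ContDiff ℝ ∞ (fun ξ' => iteratedFDeriv ℝ L₂ (b ξ') η) :=
      hDsmooth.comp (contDiff_id.prodMk contDiff_const)
    have h2 := (ContinuousMultilinearMap.apply ℝ (fun _ : Fin L₂ => Rn n) ℂ
      fun j => EuclideanSpace.single (i j) (1 : ℝ)).norm_iteratedFDeriv_comp_left (x := ξ) (n := k) h1.contDiffAt
      (by exact_mod_cast le_top)
    refine h2.trans ?_
    exact mul_le_of_le_one_left (norm_nonneg _) (norm_continuousMultilinearMap_apply_le _ (hen i))
  have hcbd : ∀ i k, ∃ K, ∀ ξ η, ‖iteratedFDeriv ℝ k (c i η) ξ‖ ≤ K := fun i k => by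
    obtain ⟨K, hK⟩ := hbd k L₂
    exact ⟨K, fun ξ η => (hcd i k ξ η).trans (hK ξ η)⟩
  have hcbd0 : ∀ i, ∃ K, ∀ ξ η, ‖c i η ξ‖ ≤ K := fun i => by
    obtain ⟨K, hK⟩ := hcbd i 0
    exact ⟨K, fun ξ η => by simpa using hK ξ η⟩
  have hinner : ∀ ξ, ∫ η, b ξ η * schwartzFT F ξ * schwartzFT G η =
      (-I) ^ L₂ * ∑ i, ∫ η, c i η ξ * (schwartzFT F ξ * schwartzFT (Gs i) η) := by
    intro ξ
    have h1 : ContDiff ℝ ∞ (b ξ) := hb.comp (contDiff_const.prodMk contDiff_id)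
    have h2 := hGs (b ξ) h1 fun k => by
      obtain ⟨K, hK⟩ := hbd 0 k
      exact ⟨K, fun η => by simpa using hK ξ η⟩
    calc ∫ η, b ξ η * schwartzFT F ξ * schwartzFT G η
        = schwartzFT F ξ * ∫ η, b ξ η * schwartzFT G η := by
          rw [← integral_const_mul]; congr 1; ext η; ring
      _ = _ := by
          rw [h2, mul_left_comm, Finset.mul_sum]
          congr 2; ext i
          rw [← integral_const_mul]; congr 1; ext η; ring
  have hint : ∀ i, Integrable (fun p : Rn n × Rn n =>
      c i p.2 p.1 * (schwartzFT F p.1 * schwartzFT (Gs i) p.2)) (volume.prod volume) := fun i => by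
    obtain ⟨K, hK⟩ := hcbd0 i
    exact integral_integral_swap_of_bounded (c := fun ξ η => c i η ξ) (hcsmooth i).continuous hK _ _
  have hW := weightMass_nonneg n s
  have hI₁ : 0 ≤ ∫ y, P₁ y := integral_nonneg hP₁
  have hI₂ : 0 ≤ ∫ y, P₂ y := integral_nonneg hP₂
  have hξ : ∀ i η, ‖∫ ξ, c i η ξ * schwartzFT F ξ‖ ≤
      (n ^ L₁ * C * weightMass n s * ∫ y, P₁ y) * (1 + ‖η‖ ^ 2) ^ (-s / 2) := by
    intro i η
    rw [hFs (c i η) (hcη i η) fun k => by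
      obtain ⟨K, hK⟩ := hcbd i k
      exact ⟨K, fun ξ => hK ξ η⟩, norm_mul, norm_pow, norm_neg, norm_I, one_pow, one_mul]
    refine (norm_sum_le_of_le (f := fun j => ∫ ξ, iteratedFDeriv ℝ L₁ (c i η) ξ
        (fun l => EuclideanSpace.single (j l) (1 : ℝ)) * schwartzFT (Fs j) ξ)
      Finset.univ (n := fun _ => (C * weightMass n s * ∫ y, P₁ y) * (1 + ‖η‖ ^ 2) ^ (-s / 2))
      fun j _ => ?_).trans (le_of_eq ?_)
    · refine (norm_integral_le_of_norm_le (g := fun ξ => (C * (∫ y, P₁ y) *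
        (1 + ‖η‖ ^ 2) ^ (-s / 2)) * (1 + ‖ξ‖ ^ 2) ^ (-s / 2))
        ((integrable_weight hs).const_mul _) (.of_forall fun ξ => ?_)).trans (le_of_eq ?_)
      · rw [norm_mul]
        have h1 : ‖iteratedFDeriv ℝ L₁ (c i η) ξ
            (fun l => EuclideanSpace.single (j l) (1 : ℝ))‖ ≤
            C * ((1 + ‖ξ‖ ^ 2) ^ (-s / 2) * (1 + ‖η‖ ^ 2) ^ (-s / 2)) := by
          refine ((iteratedFDeriv ℝ L₁ (c i η) ξ).le_opNorm _).trans ?_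
          refine (mul_le_of_le_one_right (norm_nonneg _)
            (Finset.prod_le_one (fun _ _ => norm_nonneg _) fun l _ => hen j l)).trans ?_
          refine ((hcd i L₁ ξ η).trans (hbL ξ η)).trans ?_
          gcongr
          exact rpow_one_add_norm_sq_le ξ η (by linarith [(Nat.cast_nonneg n : (0 : ℝ) ≤ n)])
        refine (mul_le_mul h1 (hFle j ξ) (norm_nonneg _) (by positivity)).trans (le_of_eq ?_)
        ring
      · rw [integral_const_mul, ← weightMass]
        ring
    · simp [Finset.sum_const, Finset.card_univ]
      ring
  have hη : ∀ i, ‖∫ ξ, ∫ η, c i η ξ * (schwartzFT F ξ * schwartzFT (Gs i) η)‖ ≤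
      n ^ L₁ * C * weightMass n s ^ 2 * ((∫ y, P₁ y) * ∫ y, P₂ y) := by
    intro i
    rw [integral_integral_swap (hint i)]
    refine (norm_integral_le_of_norm_le (g := fun η => (n ^ L₁ * C * weightMass n s *
      (∫ y, P₁ y) * (∫ y, P₂ y)) * (1 + ‖η‖ ^ 2) ^ (-s / 2))
      ((integrable_weight hs).const_mul _) (.of_forall fun η => ?_)).trans (le_of_eq ?_)
    · have h1 : ∫ ξ, c i η ξ * (schwartzFT F ξ * schwartzFT (Gs i) η) =
          (∫ ξ, c i η ξ * schwartzFT F ξ) * schwartzFT (Gs i) η := by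
        rw [← integral_mul_const]; congr 1; ext ξ; ring
      rw [h1, norm_mul]
      refine (mul_le_mul (hξ i η) (hGle i η) (norm_nonneg _) (by positivity)).trans (le_of_eq ?_)
      ring
    · rw [integral_const_mul, ← weightMass]
      ring
  simp_rw [hinner]
  rw [integral_const_mul, integral_finsetSum _ fun i _ => (hint i).integral_prod_left, norm_mul,
    norm_pow, norm_neg, norm_I, one_pow, one_mul]
  refine (norm_sum_le_of_le Finset.univ fun i _ => hη i).trans (le_of_eq ?_)
  simp [Finset.sum_const, Finset.card_univ]
  ring

/-- The translate `y ↦ f (y + x)` of a Schwartz function. -/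
def translate (f : 𝓢(Rn n, ℂ)) (x : Rn n) : 𝓢(Rn n, ℂ) := SchwartzMap.compSubConstCLM ℂ (-x) f

theorem translate_apply (f : 𝓢(Rn n, ℂ)) (x y : Rn n) : translate f x y = f (y + x) := by
  simp [translate]

theorem schwartzFT_translate (f : 𝓢(Rn n, ℂ)) (x ξ : Rn n) :
    schwartzFT (translate f x) ξ = cexp (I * ((⟪x, ξ⟫ : ℝ) : ℂ)) * schwartzFT f ξ := by
  rw [schwartzFT_apply, schwartzFT_apply, fourierT, fourierT, ← integral_const_mul,
    ← integral_add_right_eq_self (fun y =>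
      cexp (I * ((⟪x, ξ⟫ : ℝ) : ℂ)) * (f y * cexp (-I * ((⟪ξ, y⟫ : ℝ) : ℂ)))) x]
  congr 1; ext y
  rw [translate_apply, mul_left_comm, ← Complex.exp_add, inner_add_right, real_inner_comm x ξ]
  congr 2
  push_cast
  ring

theorem Tbilin_eq_translate (a : Rn n → Rn n → Rn n → ℂ) (f g : 𝓢(Rn n, ℂ)) (x : Rn n) :
    Tbilin a f g x = ∫ ξ, ∫ η, a x ξ η * schwartzFT (translate f x) ξ *
      schwartzFT (translate g x) η := by
  simp_rw [schwartzFT_translate, schwartzFT_apply, Tbilin]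
  congr 1; ext ξ; congr 1; ext η
  rw [inner_add_right]
  push_cast
  rw [mul_add, Complex.exp_add]
  ring

section SymbolClass

variable {ρ : ℝ} {a : Rn n → Rn n → Rn n → ℂ}

theorem contDiff_symbol_freq {m δ : ℝ} (ha : BilinSmRhoDelta n m ρ δ a) (x : Rn n) :
    ContDiff ℝ ∞ (fun p : Rn n × Rn n => a x p.1 p.2) :=
  ha.1.comp (contDiff_const.prodMk contDiff_id)

theorem exists_norm_symbol_freq_le (ha : BilinSmRhoDelta n 0 ρ 0 a) (k₁ k₂ : ℕ) :
    ∃ C, 0 ≤ C ∧ ∀ x ξ η, ‖iteratedFDeriv ℝ k₁ (fun ξ' => iteratedFDeriv ℝ k₂ (a x ξ') η) ξ‖ ≤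
      C * (1 + ‖ξ‖ ^ 2 + ‖η‖ ^ 2) ^ (-(ρ * (k₁ + k₂) / 2)) := by
  obtain ⟨C, hC⟩ := ha.2 0 k₁ k₂
  refine ⟨|C|, abs_nonneg _, fun x ξ η => ?_⟩
  have h := hC x ξ η
  rw [norm_iteratedFDeriv_zero] at h
  refine h.trans ?_
  have : (0 - ρ * (k₁ + k₂) + 0 * ((0 : ℕ) : ℝ)) / 2 = -(ρ * (k₁ + k₂) / 2) := by
    push_cast; ring
  rw [this]
  gcongr
  exact le_abs_self C

theorem exists_norm_symbol_freq_bounded (hρ : 0 ≤ ρ) (ha : BilinSmRhoDelta n 0 ρ 0 a)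
    (k₁ k₂ : ℕ) : ∃ C, 0 ≤ C ∧ ∀ x ξ η,
      ‖iteratedFDeriv ℝ k₁ (fun ξ' => iteratedFDeriv ℝ k₂ (a x ξ') η) ξ‖ ≤ C := by
  obtain ⟨C, hC0, hC⟩ := exists_norm_symbol_freq_le ha k₁ k₂
  refine ⟨C, hC0, fun x ξ η => (hC x ξ η).trans (mul_le_of_le_one_right hC0 ?_)⟩
  refine Real.rpow_le_one_of_one_le_of_nonpos (by nlinarith [sq_nonneg ‖ξ‖, sq_nonneg ‖η‖]) ?_
  have : 0 ≤ ρ * (k₁ + k₂) / 2 := by positivity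
  linarith

theorem exists_norm_symbol_le (hρ : 0 ≤ ρ) (ha : BilinSmRhoDelta n 0 ρ 0 a) :
    ∃ C, 0 ≤ C ∧ ∀ x ξ η, ‖a x ξ η‖ ≤ C := by
  obtain ⟨C, hC0, hC⟩ := exists_norm_symbol_freq_bounded hρ ha 0 0
  exact ⟨C, hC0, fun x ξ η => by simpa using hC x ξ η⟩

/-- Pointwise bound for the operator when at least one input lives away from the ball. -/
theorem exists_norm_Tbilin_le_of_far (hρ : 0 ≤ ρ) (ha : BilinSmRhoDelta n 0 ρ 0 a) (L₁ L₂ : ℕ)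
    (hL : (n : ℝ) < ρ * (L₁ + L₂) / 2) :
    ∃ K, 0 ≤ K ∧ ∀ (F G : 𝓢(Rn n, ℂ)) (x : Rn n),
      (L₁ ≠ 0 → ∀ y, ‖y - x‖ < 1 → F y = 0) → (L₂ ≠ 0 → ∀ y, ‖y - x‖ < 1 → G y = 0) →
      ∀ P₁ P₂ : Rn n → ℝ, (∀ y, 0 ≤ P₁ y) → (∀ y, 0 ≤ P₂ y) → Integrable P₁ → Integrable P₂ →
      (∀ y, ‖F y‖ ≤ P₁ y * ‖y - x‖ ^ L₁) → (∀ y, ‖G y‖ ≤ P₂ y * ‖y - x‖ ^ L₂) →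
      ‖Tbilin a F G x‖ ≤ K * ((∫ y, P₁ y) * ∫ y, P₂ y) := by
  obtain ⟨C, hC0, hC⟩ := exists_norm_symbol_freq_le ha L₁ L₂
  refine ⟨n ^ L₁ * n ^ L₂ * C * weightMass n (ρ * (L₁ + L₂) / 2) ^ 2, by positivity,
    fun F G x hF0 hG0 P₁ P₂ hP₁ hP₂ hP₁i hP₂i hF hG => ?_⟩
  rw [Tbilin_eq_translate]
  have h := norm_integral_integral_schwartzFT_le hC0 hL L₁ L₂ (contDiff_symbol_freq ha x)
    (fun k₁ k₂ => by
      obtain ⟨K, -, hK⟩ := exists_norm_symbol_freq_bounded hρ ha k₁ k₂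
      exact ⟨K, hK x⟩) (hC x) (translate F x) (translate G x)
    (fun h y hy => by rw [translate_apply]; exact hF0 h _ (by simpa using hy))
    (fun h y hy => by rw [translate_apply]; exact hG0 h _ (by simpa using hy))
    (P₁ := fun y => P₁ (y + x)) (P₂ := fun y => P₂ (y + x)) (fun y => hP₁ _) (fun y => hP₂ _)
    (hP₁i.comp_add_right x) (hP₂i.comp_add_right x)
    (fun y => by simpa [translate_apply] using hF (y + x))
    (fun y => by simpa [translate_apply] using hG (y + x))
  rwa [integral_add_right_eq_self, integral_add_right_eq_self] at h

end SymbolClass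

/-- The weighted `L²` mass `∫ |f|² (1 + |y - x₀|)^{-N}`. -/
def weightedMass (N : ℝ) (f : Rn n → ℂ) (x₀ : Rn n) : ℝ :=
  ∫ y : Rn n, ‖f y‖ ^ 2 * (1 + ‖y - x₀‖) ^ (-N)

theorem weightedMass_nonneg (N : ℝ) (f : Rn n → ℂ) (x₀ : Rn n) : 0 ≤ weightedMass N f x₀ :=
  integral_nonneg fun _ => by positivity

theorem continuous_weight (r : ℝ) (x₀ : Rn n) : Continuous fun y : Rn n => (1 + ‖y - x₀‖) ^ r :=
  Continuous.rpow_const (by fun_prop) fun y => Or.inl (by positivity)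

theorem weight_le_one {r : ℝ} (hr : 0 ≤ r) (x₀ y : Rn n) : (1 + ‖y - x₀‖) ^ (-r) ≤ 1 :=
  Real.rpow_le_one_of_one_le_of_nonpos (by linarith [norm_nonneg (y - x₀)]) (by linarith)

theorem integrable_norm_sq (f : 𝓢(Rn n, ℂ)) : Integrable fun y => ‖f y‖ ^ 2 :=
  (memLp_two_iff_integrable_sq_norm f.continuous.aestronglyMeasurable).1 (f.memLp 2)

theorem integrable_norm_sq_mul_weight {N : ℝ} (hN : 0 ≤ N) (f : 𝓢(Rn n, ℂ)) (x₀ : Rn n) :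
    Integrable fun y => ‖f y‖ ^ 2 * (1 + ‖y - x₀‖) ^ (-N) := by
  refine (integrable_norm_sq f).mul_bdd (c := 1)
    (continuous_weight _ _).aestronglyMeasurable (.of_forall fun y => ?_)
  rw [Real.norm_of_nonneg (by positivity)]
  exact weight_le_one hN x₀ y

theorem integrable_norm_mul_weight {M : ℝ} (hM : 0 ≤ M) (f : 𝓢(Rn n, ℂ)) (x₀ : Rn n) :
    Integrable fun y => ‖f y‖ * (1 + ‖y - x₀‖) ^ (-M) := by
  refine f.integrable.norm.mul_bdd (c := 1)
    (continuous_weight _ _).aestronglyMeasurable (.of_forall fun y => ?_)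
  rw [Real.norm_of_nonneg (by positivity)]
  exact weight_le_one hM x₀ y

theorem integral_norm_mul_weight_le {N M : ℝ} (hN : 0 ≤ N) (hM : N + n < 2 * M) (f : 𝓢(Rn n, ℂ))
    (x₀ : Rn n) : ∫ y, ‖f y‖ * (1 + ‖y - x₀‖) ^ (-M) ≤
      √(weightedMass N f x₀) * √(∫ y : Rn n, (1 + ‖y‖) ^ (-(2 * M - N))) := by
  have hint : Integrable fun y : Rn n => (1 + ‖y - x₀‖) ^ (-(2 * M - N)) :=
    (integrable_one_add_norm (μ := (volume : Measure (Rn n))) (r := 2 * M - N)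
      (by rw [finrank_euclideanSpace, Fintype.card_fin]; linarith)).comp_sub_right x₀
  have hsq : ∀ (r : ℝ) (y : Rn n), ((1 + ‖y - x₀‖) ^ (r / 2)) ^ 2 = (1 + ‖y - x₀‖) ^ r := by
    intro r y
    rw [← Real.rpow_natCast, ← Real.rpow_mul (by positivity)]
    congr 1; push_cast; ring
  have h := integral_mul_le_Lp_mul_Lq_of_nonneg (μ := (volume : Measure (Rn n)))
    (Real.HolderConjugate.two_two) (f := fun y => ‖f y‖ * (1 + ‖y - x₀‖) ^ (-N / 2))
    (g := fun y => (1 + ‖y - x₀‖) ^ (-(2 * M - N) / 2)) (.of_forall fun y => by positivity)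
    (.of_forall fun y => by positivity)
    (by
      rw [show ENNReal.ofReal 2 = 2 by simp, memLp_two_iff_integrable_sq
        (by exact (f.continuous.norm.mul (continuous_weight _ _)).aestronglyMeasurable)]
      simpa only [mul_pow, hsq] using integrable_norm_sq_mul_weight hN f x₀)
    (by
      rw [show ENNReal.ofReal 2 = 2 by simp, memLp_two_iff_integrable_sq
        (continuous_weight _ _).aestronglyMeasurable]
      simpa only [hsq] using hint)
  have h2 : ∀ r : ℝ, r ^ (2 : ℝ) = r ^ (2 : ℕ) := fun r => by norm_cast
  simp only [h2, mul_pow, hsq, ← Real.sqrt_eq_rpow] at h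
  rw [integral_sub_right_eq_self (fun y : Rn n => (1 + ‖y‖) ^ (-(2 * M - N)))] at h
  refine le_trans (le_of_eq ?_) h
  congr 1; ext y
  rw [mul_assoc, ← Real.rpow_add (by positivity)]
  congr 2; ring

/-- A smooth cutoff at `x₀`, equal to `1` on the ball of radius `2` and supported in the ball of
radius `3`. -/
def cutoff (x₀ : Rn n) : ContDiffBump x₀ := ⟨2, 3, by norm_num, by norm_num⟩

theorem hasTemperateGrowth_cutoff (x₀ : Rn n) : (cutoff x₀ : Rn n → ℝ).HasTemperateGrowth :=
  (cutoff x₀).hasCompactSupport.hasTemperateGrowth (cutoff x₀).contDiff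

/-- The part of a Schwartz function localized near `x₀`. -/
def nearPart (f : 𝓢(Rn n, ℂ)) (x₀ : Rn n) : 𝓢(Rn n, ℂ) :=
  SchwartzMap.smulLeftCLM ℂ (cutoff x₀ : Rn n → ℝ) f

theorem nearPart_apply (f : 𝓢(Rn n, ℂ)) (x₀ y : Rn n) :
    nearPart f x₀ y = (cutoff x₀ y : ℝ) • f y :=
  SchwartzMap.smulLeftCLM_apply_apply (hasTemperateGrowth_cutoff x₀) f y

theorem norm_nearPart_le (f : 𝓢(Rn n, ℂ)) (x₀ y : Rn n) : ‖nearPart f x₀ y‖ ≤ ‖f y‖ := by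
  rw [nearPart_apply, norm_smul, Real.norm_of_nonneg (cutoff x₀).nonneg]
  exact mul_le_of_le_one_left (norm_nonneg _) (cutoff x₀).le_one

theorem nearPart_eq_zero (f : 𝓢(Rn n, ℂ)) {x₀ y : Rn n} (hy : 3 ≤ ‖y - x₀‖) :
    nearPart f x₀ y = 0 := by
  rw [nearPart_apply, (cutoff x₀).zero_of_le_dist (by rwa [dist_eq_norm]), zero_smul]

/-- The part of a Schwartz function localized away from `x₀`. -/
def farPart (f : 𝓢(Rn n, ℂ)) (x₀ : Rn n) : 𝓢(Rn n, ℂ) := f - nearPart f x₀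

theorem nearPart_add_farPart (f : 𝓢(Rn n, ℂ)) (x₀ : Rn n) : nearPart f x₀ + farPart f x₀ = f := by
  simp [farPart]

theorem farPart_apply (f : 𝓢(Rn n, ℂ)) (x₀ y : Rn n) :
    farPart f x₀ y = (1 - cutoff x₀ y : ℝ) • f y := by
  simp [farPart, nearPart_apply, sub_mul]

theorem norm_farPart_le (f : 𝓢(Rn n, ℂ)) (x₀ y : Rn n) : ‖farPart f x₀ y‖ ≤ ‖f y‖ := by
  rw [farPart_apply, norm_smul, Real.norm_of_nonneg (sub_nonneg.2 (cutoff x₀).le_one)]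
  exact mul_le_of_le_one_left (norm_nonneg _) (by linarith [(cutoff x₀).nonneg (x := y)])

theorem farPart_eq_zero (f : 𝓢(Rn n, ℂ)) {x₀ y : Rn n} (hy : ‖y - x₀‖ ≤ 2) :
    farPart f x₀ y = 0 := by
  rw [farPart_apply, (cutoff x₀).one_of_mem_closedBall (by rwa [mem_closedBall, dist_eq_norm]),
    sub_self, zero_smul]

theorem norm_nearPart_le_weight (f : 𝓢(Rn n, ℂ)) (x₀ y : Rn n) (M : ℕ) :
    ‖nearPart f x₀ y‖ ≤ 4 ^ M * (‖f y‖ * (1 + ‖y - x₀‖) ^ (-(M : ℝ))) := by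
  by_cases hy : 3 ≤ ‖y - x₀‖
  · rw [nearPart_eq_zero f hy, norm_zero]; positivity
  · refine (norm_nearPart_le f x₀ y).trans ?_
    rw [Real.rpow_neg (by positivity), Real.rpow_natCast, mul_left_comm, ← div_eq_mul_inv,
      ← div_pow]
    refine le_mul_of_one_le_right (norm_nonneg _) (one_le_pow₀ ?_)
    rw [one_le_div (by positivity)]
    linarith

theorem norm_farPart_le_weight (f : 𝓢(Rn n, ℂ)) {x₀ x : Rn n} (hx : x ∈ ball x₀ 1) (y : Rn n)
    (M : ℕ) : ‖farPart f x₀ y‖ ≤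
      4 ^ M * (‖f y‖ * (1 + ‖y - x₀‖) ^ (-(M : ℝ))) * ‖y - x‖ ^ M := by
  by_cases hy : ‖y - x₀‖ ≤ 2
  · rw [farPart_eq_zero f hy, norm_zero]; positivity
  · refine (norm_farPart_le f x₀ y).trans ?_
    have h1 : ‖y - x₀‖ ≤ ‖y - x‖ + ‖x - x₀‖ := norm_sub_le_norm_sub_add_norm_sub _ _ _
    rw [mem_ball, dist_eq_norm] at hx
    rw [Real.rpow_neg (by positivity), Real.rpow_natCast]
    have h2 : 4 ^ M * (‖f y‖ * ((1 + ‖y - x₀‖) ^ M)⁻¹) * ‖y - x‖ ^ M =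
        ‖f y‖ * (4 * ‖y - x‖ / (1 + ‖y - x₀‖)) ^ M := by
      rw [div_pow, mul_pow]; ring
    rw [h2]
    refine le_mul_of_one_le_right (norm_nonneg _) (one_le_pow₀ ?_)
    rw [one_le_div (by positivity)]
    linarith

theorem farPart_eq_zero_of_mem_ball (f : 𝓢(Rn n, ℂ)) {x₀ x y : Rn n} (hx : x ∈ ball x₀ 1)
    (hy : ‖y - x‖ < 1) : farPart f x₀ y = 0 := by
  refine farPart_eq_zero f ?_
  have h1 : ‖y - x₀‖ ≤ ‖y - x‖ + ‖x - x₀‖ := norm_sub_le_norm_sub_add_norm_sub _ _ _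
  rw [mem_ball, dist_eq_norm] at hx
  linarith

/-- The contributions involving a far part are bounded uniformly on the ball by the weighted
`L²` masses. -/
theorem exists_norm_Tbilin_farPart_le {ρ : ℝ} (hρ : 0 < ρ) {a : Rn n → Rn n → Rn n → ℂ}
    (ha : BilinSmRhoDelta n 0 ρ 0 a) {N : ℝ} (hN : 0 ≤ N) :
    ∃ K, 0 ≤ K ∧ ∀ (f g : 𝓢(Rn n, ℂ)) (x₀ x : Rn n), x ∈ ball x₀ 1 →
      ‖Tbilin a (farPart f x₀) (nearPart g x₀) x‖ ≤
        K * (√(weightedMass N f x₀) * √(weightedMass N g x₀)) ∧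
      ‖Tbilin a (nearPart f x₀) (farPart g x₀) x‖ ≤
        K * (√(weightedMass N f x₀) * √(weightedMass N g x₀)) ∧
      ‖Tbilin a (farPart f x₀) (farPart g x₀) x‖ ≤
        K * (√(weightedMass N f x₀) * √(weightedMass N g x₀)) := by
  obtain ⟨M, hM⟩ := exists_nat_gt (max (2 * n / ρ) ((N + n) / 2))
  have hM1 : (n : ℝ) < ρ * M / 2 := by
    have := (le_max_left _ _).trans_lt hM
    rw [div_lt_iff₀ hρ] at this
    linarith
  have hM2 : N + n < 2 * M := by
    have := (le_max_right _ _).trans_lt hM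
    linarith
  obtain ⟨K₁, hK₁, h₁⟩ := exists_norm_Tbilin_le_of_far hρ.le ha M 0 (by simpa using hM1)
  obtain ⟨K₂, hK₂, h₂⟩ := exists_norm_Tbilin_le_of_far hρ.le ha 0 M (by simpa using hM1)
  obtain ⟨K₃, hK₃, h₃⟩ := exists_norm_Tbilin_le_of_far hρ.le ha M M (by
    have : (0 : ℝ) ≤ ρ * M := by positivity
    linarith)
  set J := √(∫ y : Rn n, (1 + ‖y‖) ^ (-(2 * (M : ℝ) - N))) with hJ
  set P : 𝓢(Rn n, ℂ) → Rn n → Rn n → ℝ :=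
    fun f x₀ y => 4 ^ M * (‖f y‖ * (1 + ‖y - x₀‖) ^ (-(M : ℝ))) with hP
  have hP0 : ∀ f x₀ y, 0 ≤ P f x₀ y := fun f x₀ y => by positivity
  have hPi : ∀ f x₀, Integrable (P f x₀) := fun f x₀ =>
    (integrable_norm_mul_weight (Nat.cast_nonneg M) f x₀).const_mul _
  have hPle : ∀ f x₀, ∫ y, P f x₀ y ≤ 4 ^ M * J * √(weightedMass N f x₀) := fun f x₀ => by
    rw [hP, integral_const_mul, mul_assoc, mul_comm J]
    gcongr
    exact integral_norm_mul_weight_le hN hM2 f x₀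
  have hPP : ∀ f g x₀ (K K' : ℝ), 0 ≤ K → K ≤ K' → K * ((∫ y, P f x₀ y) * ∫ y, P g x₀ y) ≤
      K' * (4 ^ M * J) ^ 2 * (√(weightedMass N f x₀) * √(weightedMass N g x₀)) := by
    intro f g x₀ K K' hK hKK'
    calc K * ((∫ y, P f x₀ y) * ∫ y, P g x₀ y)
        ≤ K' * ((4 ^ M * J * √(weightedMass N f x₀)) * (4 ^ M * J * √(weightedMass N g x₀))) := by
          have h1 := hPle f x₀
          have h2 := hPle g x₀
          have h4 := hK.trans hKK'
          have h3 : 0 ≤ ∫ y, P g x₀ y := integral_nonneg (hP0 g x₀)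
          gcongr
      _ = _ := by ring
  refine ⟨(K₁ + K₂ + K₃) * (4 ^ M * J) ^ 2, by positivity, fun f g x₀ x hx => ⟨?_, ?_, ?_⟩⟩
  · refine (h₁ _ _ x (fun _ y hy => farPart_eq_zero_of_mem_ball f hx hy) (fun h => absurd rfl h)
      (P f x₀) (P g x₀) (hP0 _ _) (hP0 _ _) (hPi _ _) (hPi _ _)
      (fun y => norm_farPart_le_weight f hx y M)
      (fun y => by rw [pow_zero, mul_one]; exact norm_nearPart_le_weight g x₀ y M)).trans
      (hPP f g x₀ K₁ _ hK₁ (by linarith))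
  · refine (h₂ _ _ x (fun h => absurd rfl h) (fun _ y hy => farPart_eq_zero_of_mem_ball g hx hy)
      (P f x₀) (P g x₀) (hP0 _ _) (hP0 _ _) (hPi _ _) (hPi _ _)
      (fun y => by rw [pow_zero, mul_one]; exact norm_nearPart_le_weight f x₀ y M)
      (fun y => norm_farPart_le_weight g hx y M)).trans
      (hPP f g x₀ K₂ _ hK₂ (by linarith))
  · refine (h₃ _ _ x (fun _ y hy => farPart_eq_zero_of_mem_ball f hx hy)
      (fun _ y hy => farPart_eq_zero_of_mem_ball g hx hy)
      (P f x₀) (P g x₀) (hP0 _ _) (hP0 _ _) (hPi _ _) (hPi _ _)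
      (fun y => norm_farPart_le_weight f hx y M)
      (fun y => norm_farPart_le_weight g hx y M)).trans
      (hPP f g x₀ K₃ _ hK₃ (by linarith))

theorem norm_sq_nearPart_le (f : 𝓢(Rn n, ℂ)) {N : ℝ} (hN : 0 ≤ N) (x₀ : Rn n) :
    ∫ y, ‖nearPart f x₀ y‖ ^ 2 ≤ 4 ^ N * weightedMass N f x₀ := by
  rw [weightedMass, ← integral_const_mul]
  refine integral_mono (integrable_norm_sq _)
    ((integrable_norm_sq_mul_weight hN f x₀).const_mul _) fun y => ?_
  by_cases hy : 3 ≤ ‖y - x₀‖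
  · simp only [nearPart_eq_zero f hy, norm_zero, ne_eq, OfNat.ofNat_ne_zero, not_false_eq_true,
      zero_pow]
    positivity
  · have h1 : 1 ≤ (4 : ℝ) ^ N * (1 + ‖y - x₀‖) ^ (-N) := by
      rw [Real.rpow_neg (by positivity), ← div_eq_mul_inv, one_le_div (by positivity)]
      exact Real.rpow_le_rpow (by positivity) (by linarith) hN
    calc ‖nearPart f x₀ y‖ ^ 2 ≤ ‖f y‖ ^ 2 := by gcongr; exact norm_nearPart_le f x₀ y
      _ ≤ ‖f y‖ ^ 2 * (4 ^ N * (1 + ‖y - x₀‖) ^ (-N)) := le_mul_of_one_le_right (by positivity) h1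
      _ = _ := by ring

theorem measurePreserving_shear : MeasurePreserving (fun z : Rn n × Rn n => (z.1 - z.2, z.2))
    (volume.prod volume) (volume.prod volume) :=
  measurePreserving_sub_prod volume volume

theorem measurableEmbedding_shear : MeasurableEmbedding (fun z : Rn n × Rn n => (z.1 - z.2, z.2)) :=
  Continuous.measurableEmbedding (by fun_prop) fun z w h => by
    simp only [Prod.mk.injEq] at h
    exact Prod.ext (by have := h.1; rw [h.2] at this; exact sub_left_injective this) h.2

/-- **Cauchy–Schwarz** for lower Lebesgue integrals. -/
theorem lintegral_mul_sq_le {α : Type*} [MeasurableSpace α] (μ : Measure α) {f g : α → ℝ≥0∞}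
    (hf : AEMeasurable f μ) (hg : AEMeasurable g μ) :
    (∫⁻ x, f x * g x ∂μ) ^ 2 ≤ (∫⁻ x, f x ^ 2 ∂μ) * ∫⁻ x, g x ^ 2 ∂μ := by
  have h := ENNReal.lintegral_mul_le_Lp_mul_Lq μ Real.HolderConjugate.two_two hf hg
  simp only [Pi.mul_apply, ENNReal.rpow_two] at h
  refine (pow_le_pow_left' h 2).trans (le_of_eq ?_)
  rw [mul_pow, ← ENNReal.rpow_two, ← ENNReal.rpow_two, ← ENNReal.rpow_mul, ← ENNReal.rpow_mul]
  simp

theorem lintegral_sq_le_measure_mul {α : Type*} [MeasurableSpace α] (μ : Measure α)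
    {f : α → ℝ≥0∞} (hf : AEMeasurable f μ) :
    (∫⁻ x, f x ∂μ) ^ 2 ≤ μ Set.univ * ∫⁻ x, f x ^ 2 ∂μ := by
  have h := lintegral_mul_sq_le μ (f := fun _ => 1) aemeasurable_const hf
  simpa using h

theorem lintegral_comp_smul_eq (f : Rn n → ℝ≥0∞) (hf : Measurable f) {r : ℝ} (hr : r ≠ 0) :
    ∫⁻ x, f (r • x) = ENNReal.ofReal |(r ^ n)⁻¹| * ∫⁻ x, f x := by
  rw [← lintegral_map (μ := volume) (g := fun x : Rn n => r • x) hf (by fun_prop),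
    Measure.map_addHaar_smul _ hr]
  simp

/-- The bilinear Fourier multiplier with symbol `b`. -/
def bilinMult (b : Rn n × Rn n → ℂ) (f g : 𝓢(Rn n, ℂ)) (x : Rn n) : ℂ :=
  ∫ p : Rn n × Rn n, b p * (schwartzFT f p.1 * schwartzFT g p.2) *
    cexp (I * ((⟪x, p.1 + p.2⟫ : ℝ) : ℂ))

theorem norm_cexp_I_mul_ofReal (r : ℝ) : ‖cexp (I * (r : ℂ))‖ = 1 := by
  rw [mul_comm, norm_exp_ofReal_mul_I]

theorem integrable_mul_schwartzFT {b : Rn n × Rn n → ℂ} (hb : AEStronglyMeasurable b) {K : ℝ}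
    (hK : ∀ p, ‖b p‖ ≤ K) (f g : 𝓢(Rn n, ℂ)) :
    Integrable fun p : Rn n × Rn n => b p * (schwartzFT f p.1 * schwartzFT g p.2) :=
  ((schwartzFT f).integrable.mul_prod (schwartzFT g).integrable).bdd_mul hb (.of_forall hK)

theorem integrable_bilinMult {b : Rn n × Rn n → ℂ} (hb : AEStronglyMeasurable b) {K : ℝ}
    (hK : ∀ p, ‖b p‖ ≤ K) (f g : 𝓢(Rn n, ℂ)) (x : Rn n) :
    Integrable fun p : Rn n × Rn n => b p * (schwartzFT f p.1 * schwartzFT g p.2) *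
      cexp (I * ((⟪x, p.1 + p.2⟫ : ℝ) : ℂ)) :=
  (integrable_mul_schwartzFT hb hK f g).mul_bdd (c := 1)
    (Continuous.aestronglyMeasurable (by fun_prop))
    (.of_forall fun p => (norm_cexp_I_mul_ofReal _).le)

/-- The Fourier side of a bilinear multiplier, as a function of the total frequency. -/
def totalFreq (b : Rn n × Rn n → ℂ) (f g : 𝓢(Rn n, ℂ)) (ζ : Rn n) : ℂ :=
  ∫ η, b (ζ - η, η) * (schwartzFT f (ζ - η) * schwartzFT g η)

theorem integrable_shear {b : Rn n × Rn n → ℂ} (hb : AEStronglyMeasurable b) {K : ℝ}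
    (hK : ∀ p, ‖b p‖ ≤ K) (f g : 𝓢(Rn n, ℂ)) :
    Integrable (fun p : Rn n × Rn n =>
      b (p.1 - p.2, p.2) * (schwartzFT f (p.1 - p.2) * schwartzFT g p.2))
      (volume.prod volume) :=
  (measurePreserving_shear.integrable_comp_emb measurableEmbedding_shear).2
    (integrable_mul_schwartzFT hb hK f g)

theorem bilinMult_eq_fourier {b : Rn n × Rn n → ℂ} (hb : AEStronglyMeasurable b) {K : ℝ}
    (hK : ∀ p, ‖b p‖ ≤ K) (f g : 𝓢(Rn n, ℂ)) (x : Rn n) :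
    bilinMult b f g x = 𝓕 (totalFreq b f g) (-(2 * Real.pi)⁻¹ • x) := by
  have h1 := (measurePreserving_shear (n := n)).integral_comp measurableEmbedding_shear
    (fun p : Rn n × Rn n => b p * (schwartzFT f p.1 * schwartzFT g p.2) *
      cexp (I * ((⟪x, p.1 + p.2⟫ : ℝ) : ℂ)))
  have h2 : Integrable (fun p : Rn n × Rn n =>
      b (p.1 - p.2, p.2) * (schwartzFT f (p.1 - p.2) * schwartzFT g p.2) *
      cexp (I * ((⟪x, p.1 - p.2 + p.2⟫ : ℝ) : ℂ))) (volume.prod volume) :=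
    (measurePreserving_shear.integrable_comp_emb measurableEmbedding_shear).2
      (integrable_bilinMult hb hK f g x)
  rw [bilinMult, Measure.volume_eq_prod, ← h1, integral_prod _ h2, neg_smul, ← smul_neg,
    fourier_smul_eq]
  congr 1; ext ζ
  rw [totalFreq, ← integral_mul_const]
  congr 1; ext η
  simp only [sub_add_cancel, inner_neg_left]
  push_cast
  ring_nf

theorem lintegral_totalFreq_sq_le {b : Rn n × Rn n → ℂ} (hb : StronglyMeasurable b)
    {A : ℝ≥0∞} (hA : ∀ ζ, ∫⁻ η, ‖b (ζ - η, η)‖ₑ ^ 2 ≤ A) (f g : 𝓢(Rn n, ℂ)) :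
    ∫⁻ ζ, ‖totalFreq b f g ζ‖ₑ ^ 2 ≤
      A * ((∫⁻ ξ, ‖schwartzFT f ξ‖ₑ ^ 2) * ∫⁻ ξ, ‖schwartzFT g ξ‖ₑ ^ 2) := by
  have hF : Measurable fun p : Rn n × Rn n => ‖schwartzFT f (p.1 - p.2)‖ₑ :=
    ((schwartzFT f).continuous.comp (continuous_fst.sub continuous_snd)).enorm.measurable
  have hG : Measurable fun η : Rn n => ‖schwartzFT g η‖ₑ :=
    (schwartzFT g).continuous.enorm.measurable
  have h1 : ∀ ζ, ‖totalFreq b f g ζ‖ₑ ^ 2 ≤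
      A * ∫⁻ η, ‖schwartzFT f (ζ - η)‖ₑ ^ 2 * ‖schwartzFT g η‖ₑ ^ 2 := by
    intro ζ
    have hbm : Measurable fun η => ‖b (ζ - η, η)‖ₑ :=
      (hb.measurable.comp (by fun_prop : Measurable fun η => (ζ - η, η))).enorm
    have hFm : Measurable fun η => ‖schwartzFT f (ζ - η)‖ₑ :=
      ((schwartzFT f).continuous.comp (continuous_const.sub continuous_id)).enorm.measurable
    calc ‖totalFreq b f g ζ‖ₑ ^ 2
        ≤ (∫⁻ η, ‖b (ζ - η, η)‖ₑ * (‖schwartzFT f (ζ - η)‖ₑ * ‖schwartzFT g η‖ₑ)) ^ 2 := by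
          refine pow_le_pow_left' ?_ 2
          refine (enorm_integral_le_lintegral_enorm _).trans (le_of_eq ?_)
          simp only [enorm_mul]
      _ ≤ (∫⁻ η, ‖b (ζ - η, η)‖ₑ ^ 2) *
            ∫⁻ η, (‖schwartzFT f (ζ - η)‖ₑ * ‖schwartzFT g η‖ₑ) ^ 2 :=
          lintegral_mul_sq_le _ hbm.aemeasurable (hFm.mul hG).aemeasurable
      _ ≤ _ := by
          simp only [mul_pow]
          exact mul_le_mul_left (hA ζ) _
  refine (lintegral_mono h1).trans ?_
  rw [lintegral_const_mul'' _ (by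
    exact (Measurable.lintegral_prod_right'
      (f := fun p : Rn n × Rn n => ‖schwartzFT f (p.1 - p.2)‖ₑ ^ 2 * ‖schwartzFT g p.2‖ₑ ^ 2)
      ((hF.pow_const 2).mul ((hG.comp measurable_snd).pow_const 2))).aemeasurable)]
  gcongr
  rw [lintegral_lintegral_swap (by
    exact ((hF.pow_const 2).mul ((hG.comp measurable_snd).pow_const 2)).aemeasurable)]
  refine le_of_eq ?_
  have h2 : ∀ η, ∫⁻ ζ, ‖schwartzFT f (ζ - η)‖ₑ ^ 2 * ‖schwartzFT g η‖ₑ ^ 2 =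
      (∫⁻ ξ, ‖schwartzFT f ξ‖ₑ ^ 2) * ‖schwartzFT g η‖ₑ ^ 2 := by
    intro η
    have hFm : Measurable fun ζ => ‖schwartzFT f (ζ - η)‖ₑ :=
      ((schwartzFT f).continuous.comp (continuous_id.sub continuous_const)).enorm.measurable
    rw [lintegral_mul_const _ (hFm.pow_const 2)]
    congr 1
    exact lintegral_sub_right_eq_self (fun ξ => ‖schwartzFT f ξ‖ₑ ^ 2) η
  simp_rw [h2]
  rw [lintegral_const_mul _ (hG.pow_const 2)]

theorem lintegral_schwartzFT_sq (f : 𝓢(Rn n, ℂ)) :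
    ∫⁻ ξ, ‖schwartzFT f ξ‖ₑ ^ 2 = ENNReal.ofReal ((2 * Real.pi) ^ n * ∫ y, ‖f y‖ ^ 2) := by
  rw [← integral_norm_sq_schwartzFT, ofReal_integral_eq_lintegral_ofReal
    (integrable_norm_sq (schwartzFT f)) (.of_forall fun _ => by positivity)]
  congr 1; ext ξ
  rw [ENNReal.ofReal_pow (norm_nonneg _), ofReal_norm]

theorem lintegral_bilinMult_sq_le {b : Rn n × Rn n → ℂ} (hb : StronglyMeasurable b) {K : ℝ}
    (hK : ∀ p, ‖b p‖ ≤ K) {A : ℝ≥0∞} (hAtop : A ≠ ⊤)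
    (hA : ∀ ζ, ∫⁻ η, ‖b (ζ - η, η)‖ₑ ^ 2 ≤ A) (f g : 𝓢(Rn n, ℂ)) :
    ∫⁻ x, ‖bilinMult b f g x‖ₑ ^ 2 ≤ ENNReal.ofReal ((2 * Real.pi) ^ n) * (A *
      (ENNReal.ofReal ((2 * Real.pi) ^ n * ∫ y, ‖f y‖ ^ 2) *
        ENNReal.ofReal ((2 * Real.pi) ^ n * ∫ y, ‖g y‖ ^ 2))) := by
  have h1 := lintegral_totalFreq_sq_le hb hA f g
  rw [lintegral_schwartzFT_sq, lintegral_schwartzFT_sq] at h1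
  have hint : Integrable (totalFreq b f g) :=
    (integrable_shear hb.aestronglyMeasurable hK f g).integral_prod_left
  have hL2 : MemLp (totalFreq b f g) 2 := by
    refine ⟨hint.aestronglyMeasurable, ?_⟩
    rw [eLpNorm_lt_top_iff_lintegral_rpow_enorm_lt_top (by norm_num) (by norm_num)]
    simp only [ENNReal.toReal_ofNat, ENNReal.rpow_two]
    exact h1.trans_lt (by finiteness)
  have hP : ∫⁻ ζ, ‖𝓕 (totalFreq b f g) ζ‖ₑ ^ 2 = ∫⁻ ζ, ‖totalFreq b f g ζ‖ₑ ^ 2 := by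
    have h := eLpNorm_fourier_eq hint hL2
    rw [eLpNorm_eq_lintegral_rpow_enorm_toReal (by norm_num) (by norm_num),
      eLpNorm_eq_lintegral_rpow_enorm_toReal (by norm_num) (by norm_num)] at h
    simp only [ENNReal.toReal_ofNat, ENNReal.rpow_two] at h
    exact ENNReal.rpow_left_injective (by norm_num) h
  have hcont : Continuous (𝓕 (totalFreq b f g)) :=
    VectorFourier.fourierIntegral_continuous Real.continuous_fourierChar
      (by exact continuous_inner) hint
  simp_rw [bilinMult_eq_fourier hb.aestronglyMeasurable hK]
  rw [lintegral_comp_smul_eq (fun x => ‖𝓕 (totalFreq b f g) x‖ₑ ^ 2)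
    (hcont.enorm.measurable.pow_const 2) (by simp [Real.pi_ne_zero]), hP]
  refine mul_le_mul' (le_of_eq ?_) h1
  congr 1
  rw [abs_inv, abs_pow, abs_neg, abs_inv, abs_of_pos (by positivity : 0 < 2 * Real.pi), inv_pow,
    inv_inv]

theorem cutoff_eq_cutoff_zero (x₀ y : Rn n) : cutoff x₀ y = cutoff 0 (y - x₀) := by
  simp [cutoff, ContDiffBump.apply]

theorem contDiff_ofReal_cutoff (x₀ : Rn n) : ContDiff ℝ ∞ fun y => ((cutoff x₀ y : ℝ) : ℂ) :=
  ofRealCLM.contDiff.comp (cutoff x₀).contDiff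

theorem exists_norm_iteratedFDeriv_cutoff_le (n k : ℕ) :
    ∃ C, 0 ≤ C ∧ ∀ x₀ y : Rn n, ‖iteratedFDeriv ℝ k (fun y => ((cutoff x₀ y : ℝ) : ℂ)) y‖ ≤ C := by
  have hcs : HasCompactSupport fun y : Rn n => ((cutoff 0 y : ℝ) : ℂ) :=
    (cutoff 0).hasCompactSupport.comp_left (g := fun r : ℝ => (r : ℂ)) (by simp)
  obtain ⟨C, hC⟩ := (hcs.iteratedFDeriv (𝕜 := ℝ) k).exists_bound_of_continuous
    ((contDiff_ofReal_cutoff 0).continuous_iteratedFDeriv (m := k) (by exact_mod_cast le_top))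
  refine ⟨C, (norm_nonneg _).trans (hC 0), fun x₀ y => ?_⟩
  simp_rw [cutoff_eq_cutoff_zero x₀]
  rw [iteratedFDeriv_comp_sub' k (f := fun y : Rn n => ((cutoff 0 y : ℝ) : ℂ)) x₀]
  exact hC _

/-- Multiplication of `u` by the cutoff at `x₀`. -/
def localize (x₀ : Rn n) (u : Rn n → ℂ) (x : Rn n) : ℂ := ((cutoff x₀ x : ℝ) : ℂ) * u x

theorem contDiff_localize (x₀ : Rn n) {u : Rn n → ℂ} (hu : ContDiff ℝ ∞ u) :
    ContDiff ℝ ∞ (localize x₀ u) :=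
  (contDiff_ofReal_cutoff x₀).mul hu

theorem tsupport_localize_subset (x₀ : Rn n) (u : Rn n → ℂ) :
    tsupport (localize x₀ u) ⊆ closedBall x₀ 3 := by
  refine closure_minimal (fun x hx => ?_) isClosed_closedBall
  by_contra h
  refine hx ?_
  rw [localize, (cutoff x₀).zero_of_le_dist (not_le.1 h).le]
  simp

theorem hasCompactSupport_localize (x₀ : Rn n) (u : Rn n → ℂ) :
    HasCompactSupport (localize x₀ u) :=
  (isCompact_closedBall x₀ 3).of_isClosed_subset (isClosed_tsupport _)
    (tsupport_localize_subset x₀ u)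

theorem integrable_iteratedFDeriv_localize (x₀ : Rn n) {u : Rn n → ℂ} (hu : ContDiff ℝ ∞ u)
    (k : ℕ) : Integrable (iteratedFDeriv ℝ k (localize x₀ u)) :=
  ((contDiff_localize x₀ hu).continuous_iteratedFDeriv (m := k)
    (by exact_mod_cast le_top)).integrable_of_hasCompactSupport
    ((hasCompactSupport_localize x₀ u).iteratedFDeriv k)

/-- The sum of the norms of the first derivatives of `u`. -/
def derivSum (m : ℕ) (u : Rn n → ℂ) (x : Rn n) : ℝ :=
  ∑ j ∈ Finset.range (m + 1), ‖iteratedFDeriv ℝ j u x‖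

theorem derivSum_nonneg (m : ℕ) (u : Rn n → ℂ) (x : Rn n) : 0 ≤ derivSum m u x :=
  Finset.sum_nonneg fun _ _ => norm_nonneg _

theorem continuous_derivSum (m : ℕ) {u : Rn n → ℂ} (hu : ContDiff ℝ ∞ u) :
    Continuous (derivSum m u) :=
  continuous_finsetSum _ fun j _ =>
    (hu.continuous_iteratedFDeriv (m := j) (by exact_mod_cast le_top)).norm

theorem exists_norm_iteratedFDeriv_localize_le (n m : ℕ) :
    ∃ C, 0 ≤ C ∧ ∀ (x₀ : Rn n) (u : Rn n → ℂ), ContDiff ℝ ∞ u → ∀ k ≤ m, ∀ x,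
      ‖iteratedFDeriv ℝ k (localize x₀ u) x‖ ≤ C * derivSum m u x := by
  choose C hC0 hC using exists_norm_iteratedFDeriv_cutoff_le n
  refine ⟨∑ k ∈ Finset.range (m + 1), ∑ i ∈ Finset.range (k + 1), (k.choose i : ℝ) * C i,
    Finset.sum_nonneg fun k _ => Finset.sum_nonneg fun i _ => mul_nonneg (by positivity) (hC0 i),
    fun x₀ u hu k hk x => ?_⟩
  have h := norm_iteratedFDeriv_mul_le (contDiff_ofReal_cutoff x₀) hu x (n := k)
    (by exact_mod_cast le_top)
  refine h.trans ?_
  calc ∑ i ∈ Finset.range (k + 1), (k.choose i : ℝ) *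
        ‖iteratedFDeriv ℝ i (fun y => ((cutoff x₀ y : ℝ) : ℂ)) x‖ * ‖iteratedFDeriv ℝ (k - i) u x‖
      ≤ ∑ i ∈ Finset.range (k + 1), (k.choose i : ℝ) * C i * derivSum m u x := by
        refine Finset.sum_le_sum fun i _ => ?_
        have h1 : ‖iteratedFDeriv ℝ (k - i) u x‖ ≤ derivSum m u x :=
          Finset.single_le_sum (f := fun j => ‖iteratedFDeriv ℝ j u x‖)
            (fun _ _ => norm_nonneg _) (Finset.mem_range.2 (by omega))
        have h2 := hC0 i
        have h3 := hC i x₀ x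
        gcongr
    _ = (∑ i ∈ Finset.range (k + 1), (k.choose i : ℝ) * C i) * derivSum m u x := by
        rw [Finset.sum_mul]
    _ ≤ _ := by
        refine mul_le_mul_of_nonneg_right ?_ (derivSum_nonneg m u x)
        exact Finset.single_le_sum
          (f := fun k => ∑ i ∈ Finset.range (k + 1), (k.choose i : ℝ) * C i)
          (fun k _ => Finset.sum_nonneg fun i _ => mul_nonneg (by positivity) (hC0 i))
          (Finset.mem_range.2 (by omega))

theorem exists_integral_norm_iteratedFDeriv_localize_le (n m : ℕ) :
    ∃ C, 0 ≤ C ∧ ∀ (x₀ : Rn n) (u : Rn n → ℂ), ContDiff ℝ ∞ u → ∀ k ≤ m,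
      ∫ x, ‖iteratedFDeriv ℝ k (localize x₀ u) x‖ ≤
        C * ∫ x in closedBall x₀ 3, derivSum m u x := by
  obtain ⟨C, hC0, hC⟩ := exists_norm_iteratedFDeriv_localize_le n m
  refine ⟨C, hC0, fun x₀ u hu k hk => ?_⟩
  rw [← integral_const_mul, ← setIntegral_eq_integral_of_forall_compl_eq_zero
    (s := closedBall x₀ 3)]
  · refine integral_mono (integrable_iteratedFDeriv_localize x₀ hu k).norm.integrableOn ?_
      fun x => hC x₀ u hu k hk x
    exact ((continuous_derivSum m hu).const_mul C).continuousOn.integrableOn_compact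
      (isCompact_closedBall _ _)
  · intro x hx
    rw [image_eq_zero_of_notMem_tsupport fun h => hx
      (tsupport_localize_subset x₀ u (tsupport_iteratedFDeriv_subset k h)), norm_zero]

theorem exists_norm_fourier_localize_le (n m : ℕ) :
    ∃ C, 0 ≤ C ∧ ∀ (x₀ : Rn n) (u : Rn n → ℂ), ContDiff ℝ ∞ u → ∀ θ,
      ‖𝓕 (localize x₀ u) θ‖ ≤
        C * (1 + ‖θ‖) ^ (-(m : ℝ)) * ∫ x in closedBall x₀ 3, derivSum m u x := by
  obtain ⟨C, hC0, hC⟩ := exists_integral_norm_iteratedFDeriv_localize_le n m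
  refine ⟨2 ^ m * ((2 ^ m * (m + 1) + 1) * C), by positivity, fun x₀ u hu θ => ?_⟩
  set J := ∫ x in closedBall x₀ 3, derivSum m u x with hJ
  have hJ0 : 0 ≤ J := integral_nonneg fun x => derivSum_nonneg m u x
  have key : ∀ l ≤ m, ‖θ‖ ^ l * ‖𝓕 (localize x₀ u) θ‖ ≤ 2 ^ l * ((l + 1) * (C * J)) := by
    intro l hl
    have h := Real.pow_mul_norm_iteratedFDeriv_fourier_le (K := 0) (N := m)
      ((contDiff_localize x₀ hu).of_le (by exact_mod_cast le_top)) (fun k j hk hj => by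
        have hk0 : k = 0 := by simpa using hk
        subst hk0
        simpa using (integrable_iteratedFDeriv_localize x₀ hu j).norm)
      (k := 0) (n := l) (by simp) (by exact_mod_cast hl) θ
    rw [norm_iteratedFDeriv_zero] at h
    refine h.trans ?_
    simp only [pow_zero, one_mul, CharP.cast_eq_zero, mul_zero, zero_add, Finset.range_one,
      Finset.sum_product, Finset.sum_singleton]
    gcongr
    refine (Finset.sum_le_sum (g := fun _ => C * J) fun j hj => ?_).trans (le_of_eq ?_)
    · exact hC x₀ u hu j (by rw [Finset.mem_range] at hj; omega)
    · simp
  have h0 := key 0 (Nat.zero_le _)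
  have hm := key m le_rfl
  have hconv : (1 + ‖θ‖) ^ m ≤ 2 ^ m * (1 + ‖θ‖ ^ m) := by
    rcases le_total ‖θ‖ 1 with h | h
    · calc (1 + ‖θ‖) ^ m ≤ 2 ^ m := by gcongr; linarith
        _ ≤ _ := le_mul_of_one_le_right (by positivity) (by linarith [pow_nonneg (norm_nonneg θ) m])
    · calc (1 + ‖θ‖) ^ m ≤ (2 * ‖θ‖) ^ m := by gcongr; linarith
        _ = 2 ^ m * ‖θ‖ ^ m := mul_pow _ _ _
        _ ≤ _ := by gcongr; linarith
  rw [Real.rpow_neg (by positivity), Real.rpow_natCast, mul_right_comm, ← div_eq_mul_inv,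
    le_div_iff₀ (by positivity)]
  calc ‖𝓕 (localize x₀ u) θ‖ * (1 + ‖θ‖) ^ m
      ≤ ‖𝓕 (localize x₀ u) θ‖ * (2 ^ m * (1 + ‖θ‖ ^ m)) := by gcongr
    _ = 2 ^ m * (‖θ‖ ^ 0 * ‖𝓕 (localize x₀ u) θ‖ + ‖θ‖ ^ m * ‖𝓕 (localize x₀ u) θ‖) := by ring
    _ ≤ 2 ^ m * (2 ^ 0 * (((0 : ℕ) + 1) * (C * J)) + 2 ^ m * ((m + 1) * (C * J))) := by gcongr
    _ = _ := by push_cast; ring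

theorem integrable_fourier_localize (x₀ : Rn n) {u : Rn n → ℂ} (hu : ContDiff ℝ ∞ u) :
    Integrable (𝓕 (localize x₀ u)) := by
  obtain ⟨C, hC0, hC⟩ := exists_norm_fourier_localize_le n (n + 1)
  have hint : Integrable (localize x₀ u) :=
    (contDiff_localize x₀ hu).continuous.integrable_of_hasCompactSupport
      (hasCompactSupport_localize x₀ u)
  refine Integrable.mono' (g := fun θ => C * (∫ x in closedBall x₀ 3, derivSum (n + 1) u x) *
    (1 + ‖θ‖) ^ (-((n + 1 : ℕ) : ℝ))) ?_ ?_ (.of_forall fun θ => ?_)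
  · exact (integrable_one_add_norm (by simp)).const_mul _
  · exact (VectorFourier.fourierIntegral_continuous Real.continuous_fourierChar
      (by exact continuous_inner) hint : Continuous (𝓕 (localize x₀ u))).aestronglyMeasurable
  · refine (hC x₀ u hu θ).trans (le_of_eq ?_)
    ring

theorem eq_integral_fourier_localize {x₀ x : Rn n} (hx : x ∈ ball x₀ 1) {u : Rn n → ℂ}
    (hu : ContDiff ℝ ∞ u) :
    u x = ∫ θ, cexp ((2 * Real.pi * ⟪θ, x⟫ : ℝ) * I) * 𝓕 (localize x₀ u) θ := by
  have hint : Integrable (localize x₀ u) :=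
    (contDiff_localize x₀ hu).continuous.integrable_of_hasCompactSupport
      (hasCompactSupport_localize x₀ u)
  have h := congrFun ((contDiff_localize x₀ hu).continuous.fourierInv_fourier_eq hint
    (integrable_fourier_localize x₀ hu)) x
  rw [Real.fourierInv_eq', localize, (cutoff x₀).one_of_mem_closedBall
    (ball_subset_closedBall (ball_subset_ball (by simp [cutoff]) hx))] at h
  simpa using h.symm

theorem norm_iteratedFDeriv_iteratedFDeriv_zero {E E' G : Type*} [NormedAddCommGroup E]
    [NormedSpace ℝ E] [NormedAddCommGroup E'] [NormedSpace ℝ E'] [NormedAddCommGroup G]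
    [NormedSpace ℝ G] (w : E → E' → G) (k : ℕ) (x : E) (ξ : E') :
    ‖iteratedFDeriv ℝ k (fun x' => iteratedFDeriv ℝ 0 (w x') ξ) x‖ =
      ‖iteratedFDeriv ℝ k (fun x' => w x' ξ) x‖ := by
  have h : (fun x' => iteratedFDeriv ℝ 0 (w x') ξ) =
      (continuousMultilinearCurryFin0 ℝ E' G).symm ∘ fun x' => w x' ξ := by
    ext1 x'
    rw [iteratedFDeriv_zero_eq_comp]
    rfl
  rw [h]
  exact LinearIsometryEquiv.norm_iteratedFDeriv_comp_left _ _ _ _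

theorem norm_iteratedFDeriv_freq_zero (a : Rn n → Rn n → Rn n → ℂ) (k : ℕ) (x ξ η : Rn n) :
    ‖iteratedFDeriv ℝ k (fun x' => iteratedFDeriv ℝ 0
      (fun ξ' => iteratedFDeriv ℝ 0 (fun η' => a x' ξ' η') η) ξ) x‖ =
      ‖iteratedFDeriv ℝ k (fun x' => a x' ξ η) x‖ :=
  (norm_iteratedFDeriv_iteratedFDeriv_zero
    (fun x' ξ' => iteratedFDeriv ℝ 0 (fun η' => a x' ξ' η') η) k x ξ).trans
    (norm_iteratedFDeriv_iteratedFDeriv_zero (fun x' η' => a x' ξ η') k x η)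

section SymbolSpace

variable {ρ : ℝ} {a : Rn n → Rn n → Rn n → ℂ}

theorem exists_norm_symbol_space_le (ha : BilinSmRhoDelta n 0 ρ 0 a) (k : ℕ) :
    ∃ C, 0 ≤ C ∧ ∀ x ξ η, ‖iteratedFDeriv ℝ k (fun x' => a x' ξ η) x‖ ≤ C := by
  obtain ⟨C, hC⟩ := ha.2 k 0 0
  have h : ∀ x ξ η, ‖iteratedFDeriv ℝ k (fun x' => a x' ξ η) x‖ ≤ C := fun x ξ η => by
    have := hC x ξ η
    rw [norm_iteratedFDeriv_freq_zero] at this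
    simpa using this
  exact ⟨C, (norm_nonneg _).trans (h 0 0 0), h⟩

theorem contDiff_symbol_space (ha : BilinSmRhoDelta n 0 ρ 0 a) (p : Rn n × Rn n) :
    ContDiff ℝ ∞ (fun x => a x p.1 p.2) :=
  ha.1.comp (contDiff_id.prodMk contDiff_const)

theorem continuous_iteratedFDeriv_symbol_space (ha : BilinSmRhoDelta n 0 ρ 0 a) (k : ℕ) :
    Continuous fun q : Rn n × Rn n × Rn n =>
      iteratedFDeriv ℝ k (fun x' => a x' q.2.1 q.2.2) q.1 :=
  (contDiff_iteratedFDeriv_prodMk_left ha.1 k).continuous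

theorem continuous_derivSum_symbol (ha : BilinSmRhoDelta n 0 ρ 0 a) (m : ℕ) :
    Continuous fun q : Rn n × Rn n × Rn n => derivSum m (fun x' => a x' q.2.1 q.2.2) q.1 :=
  continuous_finsetSum _ fun j _ => (continuous_iteratedFDeriv_symbol_space ha j).norm

theorem exists_derivSum_symbol_le (ha : BilinSmRhoDelta n 0 ρ 0 a) (m : ℕ) :
    ∃ C, 0 ≤ C ∧ ∀ x ξ η, derivSum m (fun x' => a x' ξ η) x ≤ C := by
  choose C hC0 hC using exists_norm_symbol_space_le ha
  exact ⟨∑ j ∈ Finset.range (m + 1), C j, Finset.sum_nonneg fun j _ => hC0 j,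
    fun x ξ η => Finset.sum_le_sum fun j _ => hC j x ξ η⟩

/-- The local mass of the `x`-derivatives of the symbol near `x₀` at a given frequency. -/
def localMass (a : Rn n → Rn n → Rn n → ℂ) (m : ℕ) (x₀ : Rn n) (p : Rn n × Rn n) : ℝ :=
  ∫ x in closedBall x₀ 3, derivSum m (fun x' => a x' p.1 p.2) x

theorem localMass_nonneg (m : ℕ) (x₀ : Rn n) (p : Rn n × Rn n) : 0 ≤ localMass a m x₀ p :=
  integral_nonneg fun _ => derivSum_nonneg _ _ _

theorem stronglyMeasurable_localMass (ha : BilinSmRhoDelta n 0 ρ 0 a) (m : ℕ) (x₀ : Rn n) :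
    StronglyMeasurable (localMass a m x₀) :=
  StronglyMeasurable.integral_prod_left
    (f := fun (x : Rn n) (p : Rn n × Rn n) => derivSum m (fun x' => a x' p.1 p.2) x)
    (continuous_derivSum_symbol ha m).stronglyMeasurable

theorem exists_localMass_le (ha : BilinSmRhoDelta n 0 ρ 0 a) (m : ℕ) :
    ∃ C, 0 ≤ C ∧ ∀ x₀ p, localMass a m x₀ p ≤ C := by
  obtain ⟨C, hC0, hC⟩ := exists_derivSum_symbol_le ha m
  refine ⟨C * volume.real (closedBall (0 : Rn n) 3), by positivity, fun x₀ p => ?_⟩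
  have h := norm_setIntegral_le_of_norm_le_const (μ := (volume : Measure (Rn n)))
    (s := closedBall x₀ 3) (f := derivSum m (fun x' => a x' p.1 p.2)) (C := C)
    (isCompact_closedBall x₀ 3).measure_lt_top (fun x _ => by
      rw [Real.norm_of_nonneg (derivSum_nonneg _ _ _)]
      exact hC x p.1 p.2)
  rw [Measure.real, Measure.addHaar_closedBall_center, ← Measure.real] at h
  exact (le_abs_self _).trans h

theorem exists_finset_closedBall_subset (n : ℕ) :
    ∃ t : Finset (Rn n), ∀ x₀ : Rn n, closedBall x₀ 3 ⊆ ⋃ c ∈ t, ball (x₀ + c) 1 := by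
  obtain ⟨t, -, htfin, ht⟩ := (isCompact_closedBall (0 : Rn n) 3).finite_cover_balls one_pos
  refine ⟨htfin.toFinset, fun x₀ x hx => ?_⟩
  have h1 : x - x₀ ∈ closedBall (0 : Rn n) 3 := by
    simpa [dist_eq_norm] using hx
  obtain ⟨c, hc, hxc⟩ := Set.mem_iUnion₂.1 (ht h1)
  refine Set.mem_iUnion₂.2 ⟨c, by simpa using hc, ?_⟩
  rw [mem_ball, dist_eq_norm] at hxc ⊢
  rwa [← sub_sub]

theorem lintegral_biUnion_finset_le_sum {α ι : Type*} [MeasurableSpace α] (μ : Measure α)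
    (t : Finset ι) (s : ι → Set α) (f : α → ℝ≥0∞) :
    ∫⁻ x in ⋃ i ∈ t, s i, f x ∂μ ≤ ∑ i ∈ t, ∫⁻ x in s i, f x ∂μ := by
  classical
  induction t using Finset.induction_on with
  | empty => simp
  | insert i t hi ih =>
    rw [Finset.set_biUnion_insert, Finset.sum_insert hi]
    exact (lintegral_union_le _ _ _).trans (by gcongr)

theorem enorm_localMass_sq_le (ha : BilinSmRhoDelta n 0 ρ 0 a) (m : ℕ) (x₀ : Rn n)
    (p : Rn n × Rn n) : ‖localMass a m x₀ p‖ₑ ^ 2 ≤ volume (closedBall (0 : Rn n) 3) * ((m + 1) *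
      ∑ j ∈ Finset.range (m + 1), ∫⁻ x in closedBall x₀ 3,
        ‖iteratedFDeriv ℝ j (fun x' => a x' p.1 p.2) x‖ₑ ^ 2) := by
  have hmeas : ∀ j, Measurable fun x => ‖iteratedFDeriv ℝ j (fun x' => a x' p.1 p.2) x‖ₑ := fun j =>
    ((contDiff_symbol_space ha p).continuous_iteratedFDeriv (m := j)
      (by exact_mod_cast le_top)).enorm.measurable
  calc ‖localMass a m x₀ p‖ₑ ^ 2
      ≤ (∫⁻ x in closedBall x₀ 3, ∑ j ∈ Finset.range (m + 1),
          ‖iteratedFDeriv ℝ j (fun x' => a x' p.1 p.2) x‖ₑ) ^ 2 := by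
        refine pow_le_pow_left' ((enorm_integral_le_lintegral_enorm _).trans
          (lintegral_mono fun x => ?_)) 2
        refine (enorm_sum_le _ _).trans (le_of_eq ?_)
        simp
    _ ≤ _ := lintegral_sq_le_measure_mul _
        (Finset.measurable_fun_sum _ fun j _ => hmeas j).aemeasurable
    _ ≤ _ := by
        rw [Measure.restrict_apply_univ, Measure.addHaar_closedBall_center]
        gcongr
        rw [← lintegral_finsetSum _ fun j _ => (hmeas j).pow_const 2,
          ← lintegral_const_mul _ (Finset.measurable_fun_sum _ fun j _ => (hmeas j).pow_const 2)]
        refine lintegral_mono fun x => ?_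
        have h := sq_sum_le_card_mul_sum_sq (s := Finset.range (m + 1))
          (f := fun j => ‖iteratedFDeriv ℝ j (fun x' => a x' p.1 p.2) x‖₊)
        rw [Finset.card_range] at h
        simp only [enorm]
        exact_mod_cast h

theorem exists_lintegral_localMass_sq_le (ha : BilinSmRhoDelta n 0 ρ 0 a)
    (hx : ∀ k : ℕ, ∃ B : ℝ, ∀ (x0 ζ : Rn n),
      ((∫⁻ x in Metric.ball x0 1, ∫⁻ η : Rn n,
          (‖iteratedFDeriv ℝ k (fun x' => a x' (ζ - η) η) x‖₊ : ℝ≥0∞) ^ (2:ℝ)) ^ ((1:ℝ)/2))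
        ≤ ENNReal.ofReal B) (m : ℕ) :
    ∃ A : ℝ, 0 ≤ A ∧ ∀ x₀ ζ, ∫⁻ η, ‖localMass a m x₀ (ζ - η, η)‖ₑ ^ 2 ≤ ENNReal.ofReal A := by
  choose B hB using hx
  obtain ⟨t, ht⟩ := exists_finset_closedBall_subset n
  set V := volume (closedBall (0 : Rn n) 3) with hV
  have hVtop : V ≠ ⊤ := (isCompact_closedBall _ _).measure_lt_top.ne
  set A : ℝ≥0∞ := V * ((m + 1) * ∑ j ∈ Finset.range (m + 1), ∑ _c ∈ t, ENNReal.ofReal (B j) ^ 2)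
    with hA
  have hAtop : A ≠ ⊤ := by
    refine ENNReal.mul_ne_top hVtop (ENNReal.mul_ne_top (by finiteness) ?_)
    refine ENNReal.sum_ne_top.2 fun j _ => ENNReal.sum_ne_top.2 fun c _ => by finiteness
  refine ⟨A.toReal, ENNReal.toReal_nonneg, fun x₀ ζ => ?_⟩
  rw [ENNReal.ofReal_toReal hAtop]
  have hcont : ∀ j, Continuous fun q : Rn n × Rn n =>
      iteratedFDeriv ℝ j (fun x' => a x' (ζ - q.1) q.1) q.2 := fun j =>
    (continuous_iteratedFDeriv_symbol_space ha j).comp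
      (by fun_prop : Continuous fun q : Rn n × Rn n => (q.2, ζ - q.1, q.1))
  have hmeas : ∀ j, Measurable fun q : Rn n × Rn n =>
      ‖iteratedFDeriv ℝ j (fun x' => a x' (ζ - q.1) q.1) q.2‖ₑ ^ 2 := fun j =>
    (hcont j).enorm.measurable.pow_const 2
  have hmeasint : ∀ j, Measurable fun η => ∫⁻ x in closedBall x₀ 3,
      ‖iteratedFDeriv ℝ j (fun x' => a x' (ζ - η) η) x‖ₑ ^ 2 := fun j =>
    (hmeas j).lintegral_prod_right'
  have hB2 : ∀ j x₁, ∫⁻ x in ball x₁ 1, ∫⁻ η,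
      ‖iteratedFDeriv ℝ j (fun x' => a x' (ζ - η) η) x‖ₑ ^ 2 ≤ ENNReal.ofReal (B j) ^ 2 := by
    intro j x₁
    have h := pow_le_pow_left' (hB j x₁ ζ) 2
    rw [← ENNReal.rpow_two, ← ENNReal.rpow_mul] at h
    simpa [enorm] using h
  calc ∫⁻ η, ‖localMass a m x₀ (ζ - η, η)‖ₑ ^ 2
      ≤ ∫⁻ η, V * ((m + 1) * ∑ j ∈ Finset.range (m + 1), ∫⁻ x in closedBall x₀ 3,
          ‖iteratedFDeriv ℝ j (fun x' => a x' (ζ - η) η) x‖ₑ ^ 2) :=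
        lintegral_mono fun η => enorm_localMass_sq_le ha m x₀ (ζ - η, η)
    _ = V * ((m + 1) * ∑ j ∈ Finset.range (m + 1), ∫⁻ x in closedBall x₀ 3, ∫⁻ η,
          ‖iteratedFDeriv ℝ j (fun x' => a x' (ζ - η) η) x‖ₑ ^ 2) := by
        have hs : Measurable fun η => ∑ j ∈ Finset.range (m + 1), ∫⁻ x in closedBall x₀ 3,
          ‖iteratedFDeriv ℝ j (fun x' => a x' (ζ - η) η) x‖ₑ ^ 2 :=
          Finset.measurable_fun_sum _ fun j _ => hmeasint j
        rw [lintegral_const_mul _ (hs.const_mul _), lintegral_const_mul _ hs,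
          lintegral_finsetSum _ fun j _ => hmeasint j]
        congr 3; ext j
        exact lintegral_lintegral_swap (hmeas j).aemeasurable
    _ ≤ A := by
        rw [hA]
        gcongr with j hj
        refine (lintegral_mono_set (ht x₀)).trans ?_
        refine (lintegral_biUnion_finset_le_sum _ _ _ _).trans ?_
        gcongr
        exact hB2 j _

end SymbolSpace

section NearEstimate

variable {ρ : ℝ} {a : Rn n → Rn n → Rn n → ℂ}

/-- The Fourier transform in `x` of the symbol localized near `x₀`. -/
def symbolFT (a : Rn n → Rn n → Rn n → ℂ) (x₀ θ : Rn n) (p : Rn n × Rn n) : ℂ :=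
  𝓕 (localize x₀ (fun x => a x p.1 p.2)) θ

theorem symbolFT_eq (a : Rn n → Rn n → Rn n → ℂ) (x₀ θ : Rn n) (p : Rn n × Rn n) :
    symbolFT a x₀ θ p = 𝓕 (localize x₀ (fun x => a x p.1 p.2)) θ := rfl

theorem stronglyMeasurable_symbolFT (ha : BilinSmRhoDelta n 0 ρ 0 a) (x₀ : Rn n) :
    StronglyMeasurable fun q : Rn n × (Rn n × Rn n) => symbolFT a x₀ q.1 q.2 := by
  simp only [symbolFT, Real.fourier_eq']
  have hc : Continuous fun r : Rn n × (Rn n × Rn n) => a r.1 r.2.1 r.2.2 := ha.1.continuous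
  have hcut : Continuous fun y => ((cutoff x₀ y : ℝ) : ℂ) := (contDiff_ofReal_cutoff x₀).continuous
  refine StronglyMeasurable.integral_prod_right (f := fun (q : Rn n × (Rn n × Rn n)) (v : Rn n) =>
    cexp (((-2 * Real.pi * ⟪v, q.1⟫ : ℝ) : ℂ) * I) •
      localize x₀ (fun x => a x q.2.1 q.2.2) v) (Continuous.stronglyMeasurable ?_)
  simp only [Function.uncurry_def, localize]
  have h1 : Continuous fun z : (Rn n × (Rn n × Rn n)) × Rn n => a z.2 z.1.2.1 z.1.2.2 :=
    hc.comp (by fun_prop : Continuous fun z : (Rn n × (Rn n × Rn n)) × Rn n => (z.2, z.1.2))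
  have h2 : Continuous fun z : (Rn n × (Rn n × Rn n)) × Rn n => ((cutoff x₀ z.2 : ℝ) : ℂ) :=
    hcut.comp continuous_snd
  exact (by fun_prop : Continuous fun z : (Rn n × (Rn n × Rn n)) × Rn n =>
    cexp (((-2 * Real.pi * ⟪z.2, z.1.1⟫ : ℝ) : ℂ) * I)).smul (h2.mul h1)

attribute [irreducible] symbolFT

theorem stronglyMeasurable_symbolFT_right (ha : BilinSmRhoDelta n 0 ρ 0 a) (x₀ θ : Rn n) :
    StronglyMeasurable (symbolFT a x₀ θ) :=
  (stronglyMeasurable_symbolFT ha x₀).comp_measurable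
    (by fun_prop : Measurable fun p : Rn n × Rn n => (θ, p))

theorem exists_norm_symbolFT_le (ha : BilinSmRhoDelta n 0 ρ 0 a) (m : ℕ) :
    ∃ C, 0 ≤ C ∧ ∀ x₀ θ p, ‖symbolFT a x₀ θ p‖ ≤
      C * (1 + ‖θ‖) ^ (-(m : ℝ)) * localMass a m x₀ p := by
  obtain ⟨C, hC0, hC⟩ := exists_norm_fourier_localize_le n m
  exact ⟨C, hC0, fun x₀ θ p => by
    rw [symbolFT_eq]
    exact hC x₀ _ (contDiff_symbol_space ha p) θ⟩

theorem exists_norm_symbolFT_le_weight (ha : BilinSmRhoDelta n 0 ρ 0 a) (m : ℕ) :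
    ∃ C, 0 ≤ C ∧ ∀ x₀ θ p, ‖symbolFT a x₀ θ p‖ ≤ C * (1 + ‖θ‖) ^ (-(m : ℝ)) := by
  obtain ⟨C, hC0, hC⟩ := exists_norm_symbolFT_le ha m
  obtain ⟨K, hK0, hK⟩ := exists_localMass_le ha m
  refine ⟨C * K, by positivity, fun x₀ θ p => (hC x₀ θ p).trans ?_⟩
  calc C * (1 + ‖θ‖) ^ (-(m : ℝ)) * localMass a m x₀ p
      ≤ C * (1 + ‖θ‖) ^ (-(m : ℝ)) * K := by gcongr; exact hK x₀ p
    _ = _ := by ring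

theorem stronglyMeasurable_bilinMult_symbolFT (ha : BilinSmRhoDelta n 0 ρ 0 a) (x₀ : Rn n)
    (f g : 𝓢(Rn n, ℂ)) :
    StronglyMeasurable fun q : Rn n × Rn n => bilinMult (symbolFT a x₀ q.1) f g q.2 := by
  refine StronglyMeasurable.integral_prod_right (f := fun (q : Rn n × Rn n) (p : Rn n × Rn n) =>
    symbolFT a x₀ q.1 p * (schwartzFT f p.1 * schwartzFT g p.2) *
      cexp (I * ((⟪q.2, p.1 + p.2⟫ : ℝ) : ℂ))) ?_
  have h1 : StronglyMeasurable fun z : (Rn n × Rn n) × (Rn n × Rn n) => symbolFT a x₀ z.1.1 z.2 :=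
    (stronglyMeasurable_symbolFT ha x₀).comp_measurable
      (by fun_prop : Measurable fun z : (Rn n × Rn n) × (Rn n × Rn n) => (z.1.1, z.2))
  have hF := (schwartzFT f).continuous
  have hG := (schwartzFT g).continuous
  exact (h1.mul (Continuous.stronglyMeasurable (by fun_prop :
    Continuous fun z : (Rn n × Rn n) × (Rn n × Rn n) =>
      schwartzFT f z.2.1 * schwartzFT g z.2.2))).mul
    (Continuous.stronglyMeasurable (by fun_prop))

theorem exists_lintegral_bilinMult_symbolFT_le (ha : BilinSmRhoDelta n 0 ρ 0 a)
    (hx : ∀ k : ℕ, ∃ B : ℝ, ∀ (x0 ζ : Rn n),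
      ((∫⁻ x in Metric.ball x0 1, ∫⁻ η : Rn n,
          (‖iteratedFDeriv ℝ k (fun x' => a x' (ζ - η) η) x‖₊ : ℝ≥0∞) ^ (2:ℝ)) ^ ((1:ℝ)/2))
        ≤ ENNReal.ofReal B) (m : ℕ) :
    ∃ C, 0 ≤ C ∧ ∀ (f g : 𝓢(Rn n, ℂ)) (x₀ θ : Rn n),
      ∫⁻ x in ball x₀ 1, ‖bilinMult (symbolFT a x₀ θ) f g x‖ₑ ≤
        ENNReal.ofReal (C * (√(∫ y, ‖f y‖ ^ 2) * √(∫ y, ‖g y‖ ^ 2)) *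
          (1 + ‖θ‖) ^ (-(m : ℝ))) := by
  obtain ⟨C, hC0, hC⟩ := exists_norm_symbolFT_le ha m
  obtain ⟨K, hK0, hK⟩ := exists_norm_symbolFT_le_weight ha m
  obtain ⟨A, hA0, hA⟩ := exists_lintegral_localMass_sq_le ha hx m
  set V := volume.real (ball (0 : Rn n) 1) with hV
  have hV0 : 0 ≤ V := by positivity
  refine ⟨C * √(V * (2 * Real.pi) ^ n * A * (2 * Real.pi) ^ n * (2 * Real.pi) ^ n),
    by positivity, fun f g x₀ θ => ?_⟩
  set w : ℝ := (1 + ‖θ‖) ^ (-(m : ℝ)) with hw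
  have hw0 : 0 ≤ w := by positivity
  have hF : 0 ≤ ∫ y, ‖f y‖ ^ 2 := by positivity
  have hG : 0 ≤ ∫ y, ‖g y‖ ^ 2 := by positivity
  have hsq : ∀ ζ, ∫⁻ η, ‖symbolFT a x₀ θ (ζ - η, η)‖ₑ ^ 2 ≤ ENNReal.ofReal ((C * w) ^ 2 * A) := by
    intro ζ
    have hm : Measurable fun η => ‖localMass a m x₀ (ζ - η, η)‖ₑ ^ 2 :=
      (((stronglyMeasurable_localMass ha m x₀).measurable.comp
        (by fun_prop : Measurable fun η => (ζ - η, η))).enorm).pow_const 2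
    calc ∫⁻ η, ‖symbolFT a x₀ θ (ζ - η, η)‖ₑ ^ 2
        ≤ ∫⁻ η, ENNReal.ofReal ((C * w) ^ 2) * ‖localMass a m x₀ (ζ - η, η)‖ₑ ^ 2 := by
          refine lintegral_mono fun η => ?_
          rw [ENNReal.ofReal_pow (by positivity), ← mul_pow]
          refine pow_le_pow_left' ?_ 2
          rw [Real.enorm_of_nonneg (localMass_nonneg _ _ _), ← ENNReal.ofReal_mul (by positivity),
            ← ofReal_norm]
          exact ENNReal.ofReal_le_ofReal (hC x₀ θ _)
      _ ≤ ENNReal.ofReal ((C * w) ^ 2) * ENNReal.ofReal A := by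
          rw [lintegral_const_mul _ hm]
          gcongr
          exact hA x₀ ζ
      _ = _ := by rw [ENNReal.ofReal_mul (by positivity)]
  have hmeas : Measurable fun x => ‖bilinMult (symbolFT a x₀ θ) f g x‖ₑ :=
    ((stronglyMeasurable_bilinMult_symbolFT ha x₀ f g).measurable.comp
      (by fun_prop : Measurable fun x : Rn n => (θ, x))).enorm
  have hmain := lintegral_bilinMult_sq_le (stronglyMeasurable_symbolFT_right ha x₀ θ) (hK x₀ θ)
    ENNReal.ofReal_ne_top hsq f g
  refine (ENNReal.pow_le_pow_left_iff two_ne_zero).1 ?_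
  calc (∫⁻ x in ball x₀ 1, ‖bilinMult (symbolFT a x₀ θ) f g x‖ₑ) ^ 2
      ≤ _ := lintegral_sq_le_measure_mul _ hmeas.aemeasurable
    _ ≤ ENNReal.ofReal V * (ENNReal.ofReal ((2 * Real.pi) ^ n) *
          (ENNReal.ofReal ((C * w) ^ 2 * A) *
            (ENNReal.ofReal ((2 * Real.pi) ^ n * ∫ y, ‖f y‖ ^ 2) *
              ENNReal.ofReal ((2 * Real.pi) ^ n * ∫ y, ‖g y‖ ^ 2)))) := by
        rw [Measure.restrict_apply_univ, Measure.addHaar_ball_center, hV,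
          ofReal_measureReal measure_ball_lt_top.ne]
        gcongr
        exact (setLIntegral_le_lintegral _ _).trans hmain
    _ = _ := by
        rw [← ENNReal.ofReal_mul (by positivity), ← ENNReal.ofReal_mul (by positivity),
          ← ENNReal.ofReal_mul (by positivity), ← ENNReal.ofReal_mul (by positivity),
          ← ENNReal.ofReal_pow (by positivity)]
        congr 1
        simp only [mul_pow]
        rw [Real.sq_sqrt (by positivity), Real.sq_sqrt hF, Real.sq_sqrt hG]
        ring

theorem Tbilin_eq_bilinMult (hρ : 0 ≤ ρ) (ha : BilinSmRhoDelta n 0 ρ 0 a) (f g : 𝓢(Rn n, ℂ))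
    (x : Rn n) : Tbilin a f g x = bilinMult (fun p => a x p.1 p.2) f g x := by
  obtain ⟨C, -, hC⟩ := exists_norm_symbol_le hρ ha
  have h := integrable_bilinMult (contDiff_symbol_freq ha x).continuous.aestronglyMeasurable
    (fun p => hC x p.1 p.2) f g x
  rw [bilinMult, Measure.volume_eq_prod, integral_prod _ h, Tbilin]
  congr 1; ext ξ; congr 1; ext η
  simp only [schwartzFT_apply]
  ring

theorem bilinMult_eq_integral_symbolFT (ha : BilinSmRhoDelta n 0 ρ 0 a) (f g : 𝓢(Rn n, ℂ))
    {x₀ x : Rn n} (hxx : x ∈ ball x₀ 1) : bilinMult (fun p => a x p.1 p.2) f g x =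
      ∫ θ, cexp (((2 * Real.pi * ⟪θ, x⟫ : ℝ) : ℂ) * I) * bilinMult (symbolFT a x₀ θ) f g x := by
  obtain ⟨K, hK0, hK⟩ := exists_norm_symbolFT_le_weight ha (n + 1)
  have hw : Integrable fun θ : Rn n => K * (1 + ‖θ‖) ^ (-((n + 1 : ℕ) : ℝ)) :=
    (integrable_one_add_norm (by simp)).const_mul K
  have hFG : Integrable fun p : Rn n × Rn n => schwartzFT f p.1 * schwartzFT g p.2 :=
    (schwartzFT f).integrable.mul_prod (schwartzFT g).integrable
  have hint : Integrable (Function.uncurry fun (p : Rn n × Rn n) (θ : Rn n) =>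
      cexp (((2 * Real.pi * ⟪θ, x⟫ : ℝ) : ℂ) * I) * symbolFT a x₀ θ p *
        (schwartzFT f p.1 * schwartzFT g p.2) * cexp (I * ((⟪x, p.1 + p.2⟫ : ℝ) : ℂ)))
      (volume.prod volume) := by
    refine (hFG.norm.mul_prod hw).mono' ?_ (.of_forall fun z => ?_)
    · have h1 : StronglyMeasurable fun z : (Rn n × Rn n) × Rn n => symbolFT a x₀ z.2 z.1 :=
        (stronglyMeasurable_symbolFT ha x₀).comp_measurable measurable_swap
      have hF := (schwartzFT f).continuous
      have hG := (schwartzFT g).continuous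
      exact (((Continuous.stronglyMeasurable (by fun_prop)).mul h1).mul
        (Continuous.stronglyMeasurable (by fun_prop :
          Continuous fun z : (Rn n × Rn n) × Rn n =>
            schwartzFT f z.1.1 * schwartzFT g z.1.2))).mul
        (Continuous.stronglyMeasurable (by fun_prop)) |>.aestronglyMeasurable
    · simp only [Function.uncurry]
      rw [norm_mul, norm_cexp_I_mul_ofReal, mul_one, norm_mul, norm_mul, norm_exp_ofReal_mul_I,
        one_mul, mul_comm]
      gcongr
      exact hK x₀ z.2 z.1
  have hswap := integral_integral_swap hint
  calc bilinMult (fun p => a x p.1 p.2) f g x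
      = ∫ p : Rn n × Rn n, ∫ θ, cexp (((2 * Real.pi * ⟪θ, x⟫ : ℝ) : ℂ) * I) * symbolFT a x₀ θ p *
        (schwartzFT f p.1 * schwartzFT g p.2) * cexp (I * ((⟪x, p.1 + p.2⟫ : ℝ) : ℂ)) := by
        rw [bilinMult]
        congr 1; ext p
        rw [integral_mul_const, integral_mul_const,
          eq_integral_fourier_localize hxx (contDiff_symbol_space ha p)]
        simp only [symbolFT_eq]
    _ = _ := by
        rw [hswap]
        congr 1; ext θ
        rw [bilinMult, ← integral_const_mul]
        congr 1; ext p
        ring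

theorem exists_lintegral_Tbilin_le (hρ : 0 ≤ ρ) (ha : BilinSmRhoDelta n 0 ρ 0 a)
    (hx : ∀ k : ℕ, ∃ B : ℝ, ∀ (x0 ζ : Rn n),
      ((∫⁻ x in Metric.ball x0 1, ∫⁻ η : Rn n,
          (‖iteratedFDeriv ℝ k (fun x' => a x' (ζ - η) η) x‖₊ : ℝ≥0∞) ^ (2:ℝ)) ^ ((1:ℝ)/2))
        ≤ ENNReal.ofReal B) :
    ∃ C, 0 ≤ C ∧ ∀ (f g : 𝓢(Rn n, ℂ)) (x₀ : Rn n), ∫⁻ x in ball x₀ 1, ‖Tbilin a f g x‖ₑ ≤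
      ENNReal.ofReal (C * (√(∫ y, ‖f y‖ ^ 2) * √(∫ y, ‖g y‖ ^ 2))) := by
  obtain ⟨C, hC0, hC⟩ := exists_lintegral_bilinMult_symbolFT_le ha hx (n + 1)
  have hw : Integrable fun θ : Rn n => (1 + ‖θ‖) ^ (-((n + 1 : ℕ) : ℝ)) :=
    integrable_one_add_norm (by simp)
  refine ⟨C * ∫ θ : Rn n, (1 + ‖θ‖) ^ (-((n + 1 : ℕ) : ℝ)), by positivity, fun f g x₀ => ?_⟩
  have hmeas := (stronglyMeasurable_bilinMult_symbolFT ha x₀ f g).measurable.enorm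
  calc ∫⁻ x in ball x₀ 1, ‖Tbilin a f g x‖ₑ
      ≤ ∫⁻ x in ball x₀ 1, ∫⁻ θ, ‖bilinMult (symbolFT a x₀ θ) f g x‖ₑ := by
        refine setLIntegral_mono' measurableSet_ball fun x hxx => ?_
        rw [Tbilin_eq_bilinMult hρ ha, bilinMult_eq_integral_symbolFT ha f g hxx]
        refine (enorm_integral_le_lintegral_enorm _).trans (lintegral_mono fun θ => ?_)
        rw [enorm_mul, ← ofReal_norm, norm_exp_ofReal_mul_I, ENNReal.ofReal_one, one_mul]
    _ = ∫⁻ θ, ∫⁻ x in ball x₀ 1, ‖bilinMult (symbolFT a x₀ θ) f g x‖ₑ :=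
        lintegral_lintegral_swap (hmeas.comp measurable_swap).aemeasurable
    _ ≤ ∫⁻ θ : Rn n, ENNReal.ofReal (C * (√(∫ y, ‖f y‖ ^ 2) * √(∫ y, ‖g y‖ ^ 2)) *
          (1 + ‖θ‖) ^ (-((n + 1 : ℕ) : ℝ))) := lintegral_mono fun θ => hC f g x₀ θ
    _ = _ := by
        rw [← ofReal_integral_eq_lintegral_ofReal (hw.const_mul _)
          (.of_forall fun θ => by positivity), integral_const_mul]
        congr 1
        ring

end NearEstimate

section Decomposition

variable {ρ : ℝ} {a : Rn n → Rn n → Rn n → ℂ}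

theorem Tbilin_add_add (hρ : 0 ≤ ρ) (ha : BilinSmRhoDelta n 0 ρ 0 a) (f₁ f₂ g₁ g₂ : 𝓢(Rn n, ℂ))
    (x : Rn n) : Tbilin a ⇑(f₁ + f₂) ⇑(g₁ + g₂) x =
      Tbilin a f₁ g₁ x + Tbilin a f₂ g₁ x + Tbilin a f₁ g₂ x + Tbilin a f₂ g₂ x := by
  obtain ⟨C, -, hC⟩ := exists_norm_symbol_le hρ ha
  have h : ∀ f g : 𝓢(Rn n, ℂ), _ := fun f g =>
    integrable_bilinMult (contDiff_symbol_freq ha x).continuous.aestronglyMeasurable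
      (fun p => hC x p.1 p.2) f g x
  simp only [Tbilin_eq_bilinMult hρ ha, bilinMult]
  rw [← integral_add' (h f₁ g₁) (h f₂ g₁), ← integral_add' ((h f₁ g₁).add (h f₂ g₁)) (h f₁ g₂),
    ← integral_add' (((h f₁ g₁).add (h f₂ g₁)).add (h f₁ g₂)) (h f₂ g₂)]
  congr 1; ext p
  simp only [schwartzFT_add, add_apply, Pi.add_apply]
  ring

theorem exists_setIntegral_norm_Tbilin_le (hρ : 0 < ρ) (ha : BilinSmRhoDelta n 0 ρ 0 a)
    (hx : ∀ k : ℕ, ∃ B : ℝ, ∀ (x0 ζ : Rn n),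
      ((∫⁻ x in Metric.ball x0 1, ∫⁻ η : Rn n,
          (‖iteratedFDeriv ℝ k (fun x' => a x' (ζ - η) η) x‖₊ : ℝ≥0∞) ^ (2:ℝ)) ^ ((1:ℝ)/2))
        ≤ ENNReal.ofReal B) {N : ℝ} (hN : 0 ≤ N) :
    ∃ C, 0 ≤ C ∧ ∀ (f g : 𝓢(Rn n, ℂ)) (x₀ : Rn n), ∫ x in ball x₀ 1, ‖Tbilin a f g x‖ ≤
      C * (√(weightedMass N f x₀) * √(weightedMass N g x₀)) := by
  obtain ⟨C, hC0, hC⟩ := exists_lintegral_Tbilin_le hρ.le ha hx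
  obtain ⟨K, hK0, hK⟩ := exists_norm_Tbilin_farPart_le hρ ha hN
  set V := volume.real (ball (0 : Rn n) 1) with hV
  have hV0 : 0 ≤ V := by positivity
  refine ⟨C * 4 ^ N + 3 * K * V, by positivity, fun f g x₀ => ?_⟩
  set R := √(weightedMass N f x₀) * √(weightedMass N g x₀) with hR
  have hR0 : 0 ≤ R := by positivity
  have hnear : √(∫ y, ‖nearPart f x₀ y‖ ^ 2) * √(∫ y, ‖nearPart g x₀ y‖ ^ 2) ≤ 4 ^ N * R := by
    calc _ ≤ √(4 ^ N * weightedMass N f x₀) * √(4 ^ N * weightedMass N g x₀) := by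
          gcongr
          exacts [norm_sq_nearPart_le f hN x₀, norm_sq_nearPart_le g hN x₀]
      _ = (√(4 ^ N) * √(4 ^ N)) * R := by
          rw [Real.sqrt_mul (by positivity), Real.sqrt_mul (by positivity)]
          ring
      _ = _ := by rw [Real.mul_self_sqrt (by positivity)]
  have hpt : ∀ x ∈ ball x₀ 1, ‖Tbilin a f g x‖ₑ ≤
      ‖Tbilin a (nearPart f x₀) (nearPart g x₀) x‖ₑ + ENNReal.ofReal (3 * K * R) := by
    intro x hxx
    obtain ⟨h1, h2, h3⟩ := hK f g x₀ x hxx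
    have h4 := Tbilin_add_add hρ.le ha (nearPart f x₀) (farPart f x₀) (nearPart g x₀)
      (farPart g x₀) x
    rw [nearPart_add_farPart, nearPart_add_farPart] at h4
    rw [← ofReal_norm, ← ofReal_norm, ← ENNReal.ofReal_add (norm_nonneg _) (by positivity)]
    refine ENNReal.ofReal_le_ofReal ?_
    rw [h4]
    refine (norm_add₄_le).trans ?_
    linarith
  by_cases hint : IntegrableOn (fun x => ‖Tbilin a f g x‖) (ball x₀ 1)
  swap
  · rw [integral_undef hint]
    positivity
  refine (ENNReal.ofReal_le_ofReal_iff (by positivity)).1 ?_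
  rw [ofReal_integral_eq_lintegral_ofReal hint (.of_forall fun _ => norm_nonneg _)]
  calc ∫⁻ x in ball x₀ 1, ENNReal.ofReal ‖Tbilin a f g x‖
      ≤ ∫⁻ x in ball x₀ 1, (‖Tbilin a (nearPart f x₀) (nearPart g x₀) x‖ₑ +
          ENNReal.ofReal (3 * K * R)) := by
        refine setLIntegral_mono' measurableSet_ball fun x hxx => ?_
        rw [ofReal_norm]
        exact hpt x hxx
    _ = (∫⁻ x in ball x₀ 1, ‖Tbilin a (nearPart f x₀) (nearPart g x₀) x‖ₑ) +
          ENNReal.ofReal (3 * K * R) * ENNReal.ofReal V := by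
        rw [lintegral_add_right _ measurable_const, setLIntegral_const,
          Measure.addHaar_ball_center, hV, ofReal_measureReal measure_ball_lt_top.ne]
    _ ≤ ENNReal.ofReal (C * (4 ^ N * R)) + ENNReal.ofReal (3 * K * R) * ENNReal.ofReal V := by
        gcongr
        refine (hC _ _ x₀).trans (ENNReal.ofReal_le_ofReal ?_)
        gcongr
    _ = _ := by
        rw [← ENNReal.ofReal_mul (by positivity), ← ENNReal.ofReal_add (by positivity)
          (by positivity)]
        congr 1
        ring

end Decomposition

end BilinearPseudo

theorem statement19 (n : ℕ) (ρ : ℝ) (hρ0 : 0 < ρ) (hρ1 : ρ ≤ 1)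
    (a : Rn n → Rn n → Rn n → ℂ) (ha : BilinSmRhoDelta n 0 ρ 0 a)
    (hx : ∀ k : ℕ, ∃ B : ℝ, ∀ (x0 ζ : Rn n),
      ((∫⁻ x in Metric.ball x0 1, ∫⁻ η : Rn n,
          (‖iteratedFDeriv ℝ k (fun x' => a x' (ζ - η) η) x‖₊ : ℝ≥0∞) ^ (2:ℝ)) ^ ((1:ℝ)/2))
        ≤ ENNReal.ofReal B)
    (NN : ℝ) (hNN : (n : ℝ) < NN) :
    ∃ Cst : ℝ, 0 < Cst ∧ ∀ (f g : SchwartzMap (Rn n) ℂ) (x0 : Rn n),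
      (∫ x in Metric.ball x0 1, ‖Tbilin a (⇑f) (⇑g) x‖) ≤
        Cst * Real.sqrt
          ((∫ y : Rn n, ‖f y‖ ^ 2 * (1 + ‖y - x0‖) ^ (-NN)) *
           (∫ z : Rn n, ‖g z‖ ^ 2 * (1 + ‖z - x0‖) ^ (-NN))) := by
  obtain ⟨C, hC0, hC⟩ := BilinearPseudo.exists_setIntegral_norm_Tbilin_le hρ0 ha hx
    ((Nat.cast_nonneg n).trans hNN.le)
  refine ⟨C + 1, by positivity, fun f g x0 => (hC f g x0).trans ?_⟩
  rw [← Real.sqrt_mul (BilinearPseudo.weightedMass_nonneg NN f x0)]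
  exact mul_le_mul_of_nonneg_right (by linarith) (Real.sqrt_nonneg _)
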